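/- Let V be a finite-dimensional real inner product space, κ ∈ ℝ, and let R : ℝ → End(V) be a smooth family of self-adjoint endomorphisms satisfying the radial intermediate Ricci bound Ric_k ≥ k·κ. Let Λ be a Lagrangian subspace of abstract Jacobi fields for R, let t₀ < t_max, and let λ̃ : [t₀, t_max) → ℝ be a solution of the scalar Riccati equation with parameter κ. Let W ⊆ V be a k-dimensional subspace contained in {J(t₀) : J ∈ Λ} such that for some orthonormal basis (e₁, …, e_k) of W and some J₁, …, J_k ∈ Λ with Jᵢ(t₀) = eᵢ one has Σᵢ ⟨Jᵢ'(t₀), eᵢ⟩ ≤ k·λ̃(t₀). Let 𝒱 := {J ∈ Λ : J(t₀) ⊥ W}, assume 𝒱 has full index on [t₀, t_max), and let H(t) denote the orthogonal complement of 𝒱(t) in V. Suppose that for some t₁ ∈ [t₀, t_max), some orthonormal basis (x₁, …, x_k) of H(t₁), and some K₁, …, K_k ∈ Λ with Kᵢ(t₁) = xᵢ, one has Σᵢ ⟨Kᵢ'(t₁), xᵢ⟩ = k·λ̃(t₁). Then there is a subspace ℋ ⊆ Λ with Λ = 𝒱 ⊕ ℋ such that ⟨J(t), K(t)⟩ = 0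 for all t ∈ [t₀, t₁], J ∈ 𝒱, K ∈ ℋ, and such that every nonzero K ∈ ℋ satisfies K(t) = f(t)·E on [t₀, t₁], where E is a unit vector of V lying in H(t₀) and f : [t₀, t₁] → ℝ solves f'' + κ·f = 0 with f(t₀) = |K(t₀)|. -/

import Mathlib

open RealInnerProductSpace

variable {V : Type*} [NormedAddCommGroup V] [InnerProductSpace ℝ V]

/-- `J : ℝ → V` is an abstract Jacobi field for the curvature family `R`. -/
def IsJacobiField (R : ℝ → V →L[ℝ] V) (J : ℝ → V) : Prop :=
  ContDiff ℝ (⊤ : ℕ∞) J ∧ ∀ t : ℝ, deriv (deriv J) t = -(R t (J t))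

/-- A Lagrangian subspace of abstract Jacobi fields: a subspace of the space of
Jacobi fields for `R` of dimension `dim V` on which the Wronskian vanishes. -/
def IsLagrangian [FiniteDimensional ℝ V] (R : ℝ → V →L[ℝ] V)
    (Λ : Submodule ℝ (ℝ → V)) : Prop :=
  (∀ J ∈ Λ, IsJacobiField R J) ∧
    Module.finrank ℝ Λ = Module.finrank ℝ V ∧
    ∀ J₁ ∈ Λ, ∀ J₂ ∈ Λ, ∀ t : ℝ, ⟪deriv J₁ t, J₂ t⟫ = ⟪J₁ t, deriv J₂ t⟫

/-- `𝒲(t) = {J(t) : J ∈ 𝒲} + {J'(t) : J ∈ 𝒲, J(t) = 0}`. -/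
def evalSp (𝒲 : Submodule ℝ (ℝ → V)) (t : ℝ) : Submodule ℝ V :=
  Submodule.span ℝ
    ({x : V | ∃ J ∈ 𝒲, J t = x} ∪ {x : V | ∃ J ∈ 𝒲, J t = 0 ∧ deriv J t = x})

open Filter Topology Asymptotics

/-- A family of operators on a finite-dimensional space is differentiable as soon as it is
pointwise differentiable. -/
theorem differentiableAt_clm_of_apply [FiniteDimensional ℝ V] {F : ℝ → V →L[ℝ] V} {a : ℝ}
    (h : ∀ v, DifferentiableAt ℝ (fun t => F t v) a) : DifferentiableAt ℝ F a := by
  let b := stdOrthonormalBasis ℝ V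
  have key : F = fun t =>
      ∑ i, (ContinuousLinearMap.smulRightL ℝ V V (innerSL ℝ (b i))) (F t (b i)) := by
    ext t v
    conv_lhs => rw [← b.sum_repr' v]
    simp
  rw [key]
  exact DifferentiableAt.fun_sum fun i _ =>
    (ContinuousLinearMap.smulRightL ℝ V V (innerSL ℝ (b i))).differentiableAt.comp a (h (b i))

theorem hasDerivAt_clm_of_apply [FiniteDimensional ℝ V] {F : ℝ → V →L[ℝ] V} {F' : V →L[ℝ] V}
    {a : ℝ} (h : ∀ v, HasDerivAt (fun t => F t v) (F' v) a) : HasDerivAt F F' a := by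
  have hd := (differentiableAt_clm_of_apply fun v => (h v).differentiableAt).hasDerivAt
  have : deriv F a = F' := ContinuousLinearMap.ext fun v =>
    by simpa using (hd.clm_apply (hasDerivAt_const a v)).unique (h v)
  exact this ▸ hd

/-- The derivative of `dslope Z a` away from `a`, extended by `0` at `a`. -/
noncomputable def dslopeDeriv (Z : ℝ → V) (a t : ℝ) : V :=
  (t - a)⁻¹ • (deriv Z t - dslope Z a t)

theorem taylor_two_isLittleO {Z : ℝ → V} {a : ℝ} (hZ : ContDiff ℝ (⊤ : ℕ∞) Z) :
    (fun t => Z t - (Z a + (t - a) • deriv Z a + ((t - a) ^ 2 / 2) • deriv (deriv Z) a))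
      =o[𝓝 a] fun t => (t - a) ^ 2 := by
  have h := taylor_isLittleO_univ (x₀ := a) (n := 2) (contDiff_infty.1 hZ 2)
  refine h.congr_left fun t => ?_
  simp [taylorWithinEval_succ, iteratedDerivWithin_univ, iteratedDeriv_succ, div_eq_inv_mul,
    mul_comm]
  norm_num

theorem taylor_three_isLittleO {Z : ℝ → V} {a : ℝ} (hZ : ContDiff ℝ (⊤ : ℕ∞) Z) :
    (fun t => Z t - (Z a + (t - a) • deriv Z a + ((t - a) ^ 2 / 2) • deriv (deriv Z) a
      + ((t - a) ^ 3 / 6) • deriv (deriv (deriv Z)) a)) =o[𝓝 a] fun t => (t - a) ^ 3 := by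
  have h := taylor_isLittleO_univ (x₀ := a) (n := 3) (contDiff_infty.1 hZ 3)
  refine h.congr_left fun t => ?_
  simp [taylorWithinEval_succ, iteratedDerivWithin_univ, iteratedDeriv_succ, div_eq_inv_mul,
    mul_comm]
  norm_num

theorem hasDerivAt_of_sub_isLittleO {f : ℝ → V} {c : V} {a : ℝ} {g : ℝ → V} {n : ℕ}
    (hg : g =o[𝓝 a] fun t => (t - a) ^ (n + 1))
    (h : ∀ t, t ≠ a → f t - f a - (t - a) • c = ((t - a) ^ n)⁻¹ • g t) :
    HasDerivAt f c a := by
  rw [hasDerivAt_iff_isLittleO]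
  rw [isLittleO_iff] at hg ⊢
  intro ε hε
  filter_upwards [hg hε] with t ht
  rcases eq_or_ne t a with rfl | hne
  · simp
  · have hpos : 0 < ‖t - a‖ := norm_pos_iff.2 (sub_ne_zero.2 hne)
    rw [h t hne, norm_smul, norm_inv, norm_pow, inv_mul_le_iff₀ (by positivity)]
    rw [norm_pow] at ht
    calc ‖g t‖ ≤ _ := ht
      _ = _ := by ring

theorem hasDerivAt_dslope_self {Z : ℝ → V} {a : ℝ} (hZ : ContDiff ℝ (⊤ : ℕ∞) Z) (h0 : Z a = 0)
    (h2 : deriv (deriv Z) a = 0) : HasDerivAt (dslope Z a) 0 a := by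
  refine hasDerivAt_of_sub_isLittleO (n := 1) (taylor_two_isLittleO hZ) fun t ht => ?_
  have : t - a ≠ 0 := sub_ne_zero.2 ht
  simp only [dslope_of_ne _ ht, dslope_same, slope, h0, h2, vsub_eq_sub]
  match_scalars <;> field_simp

theorem differentiableAt_dslopeDeriv {Z : ℝ → V} {a : ℝ} (hZ : ContDiff ℝ (⊤ : ℕ∞) Z)
    (h0 : Z a = 0) (h2 : deriv (deriv Z) a = 0) : DifferentiableAt ℝ (dslopeDeriv Z a) a := by
  have hZ' : ContDiff ℝ (⊤ : ℕ∞) (deriv Z) := (contDiff_infty_iff_deriv.1 hZ).2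
  have h3 := (((isBigO_refl (fun t : ℝ => t - a) (𝓝 a)).smul_isLittleO
    (taylor_two_isLittleO (a := a) hZ')).congr_right (g₂ := fun t => (t - a) ^ 3)
      fun t => by simp; ring).sub (taylor_three_isLittleO (a := a) hZ)
  refine HasDerivAt.differentiableAt (f' := (3 : ℝ)⁻¹ • deriv (deriv (deriv Z)) a) ?_
  refine hasDerivAt_of_sub_isLittleO (n := 2) h3 fun t ht => ?_
  have : t - a ≠ 0 := sub_ne_zero.2 ht
  simp only [dslopeDeriv, dslope_of_ne _ ht, dslope_same, slope, h0, h2, vsub_eq_sub]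
  match_scalars <;> field_simp <;> ring

open Set in
theorem second_order_eq_zero {z z' z'' : ℝ → V} {a b C : ℝ}
    (h1 : ∀ t ∈ Icc a b, HasDerivAt z (z' t) t) (h2 : ∀ t ∈ Icc a b, HasDerivAt z' (z'' t) t)
    (hC : ∀ t ∈ Icc a b, ‖z'' t‖ ≤ C * ‖z t‖) (h0 : z a = 0) (h0' : z' a = 0) :
    ∀ t ∈ Icc a b, z t = 0 ∧ z' t = 0 := by
  have hd : ∀ t ∈ Icc a b, HasDerivAt (fun s => (z s, z' s)) (z' t, z'' t) t :=
    fun t ht => (h1 t ht).prodMk (h2 t ht)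
  have := eq_zero_of_abs_deriv_le_mul_abs_self_of_eq_zero_right (K := max 1 C)
    (fun t ht => (hd t ht).continuousAt.continuousWithinAt)
    (fun t ht => (hd t (Ico_subset_Icc_self ht)).hasDerivWithinAt) (by simp [h0, h0'])
    (fun t ht => by
      have hm : 0 ≤ max 1 C := zero_le_one.trans (le_max_left _ _)
      refine max_le ?_ ?_
      · calc ‖z' t‖ ≤ max 1 C * ‖z' t‖ := le_mul_of_one_le_left (norm_nonneg _) (le_max_left _ _)
          _ ≤ _ := mul_le_mul_of_nonneg_left (le_max_right _ _) hm
      · calc ‖z'' t‖ ≤ C * ‖z t‖ := hC t (Ico_subset_Icc_self ht)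
          _ ≤ max 1 C * ‖z t‖ := mul_le_mul_of_nonneg_right (le_max_right _ _) (norm_nonneg _)
          _ ≤ _ := mul_le_mul_of_nonneg_left (le_max_left _ _) hm)
  intro t ht
  simpa using this t ht

theorem exists_norm_le_Icc {R : ℝ → V →L[ℝ] V} (hR : Continuous R) (a b : ℝ) :
    ∃ C, ∀ t ∈ Set.Icc a b, ‖R t‖ ≤ C :=
  isCompact_Icc.exists_bound_of_continuousOn hR.continuousOn

namespace IsJacobiField

variable {R : ℝ → V →L[ℝ] V} {J : ℝ → V}

theorem hasDerivAt (hJ : IsJacobiField R J) (t : ℝ) : HasDerivAt J (deriv J t) t :=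
  (hJ.1.differentiable (by simp) t).hasDerivAt

theorem hasDerivAt_deriv (hJ : IsJacobiField R J) (t : ℝ) :
    HasDerivAt (deriv J) (-(R t (J t))) t := by
  rw [← hJ.2 t]
  exact ((contDiff_infty_iff_deriv.1 hJ.1).2.differentiable (by simp) t).hasDerivAt

theorem eq_zero (hR : Continuous R) (hJ : IsJacobiField R J) {a : ℝ} (h0 : J a = 0)
    (h0' : deriv J a = 0) : J = 0 := by
  funext t
  rcases le_total a t with h | h
  · obtain ⟨C, hC⟩ := exists_norm_le_Icc hR a t
    refine (second_order_eq_zero (C := C) (fun s _ => hJ.hasDerivAt s)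
      (fun s _ => hJ.hasDerivAt_deriv s) (fun s hs => ?_) h0 h0' t ⟨h, le_rfl⟩).1
    rw [norm_neg]
    exact (R s).le_of_opNorm_le (hC s hs) _
  · obtain ⟨C, hC⟩ := exists_norm_le_Icc hR t a
    have hrev : ∀ s : ℝ, HasDerivAt (fun s : ℝ => -s) (-1) s := fun s => hasDerivAt_neg s
    have := second_order_eq_zero (a := -a) (b := -t) (C := C)
      (fun s _ => (hJ.hasDerivAt (-s)).scomp s (hrev s))
      (z'' := fun s => -(R (-s) (J (-s))))
      (fun s _ => by
        have := ((hJ.hasDerivAt_deriv (-s)).scomp s (hrev s)).const_smul (-1 : ℝ)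
        simpa using! this)
      (fun s hs => by
        rw [norm_neg]
        exact (R (-s)).le_of_opNorm_le (hC _ ⟨by linarith [hs.2], by linarith [hs.1]⟩) _)
      (by simpa using h0) (by simpa using h0') (-t) ⟨by linarith, le_rfl⟩
    simpa using this.1

end IsJacobiField

/-- The span of the derivatives at `t` of the members of `Λ` that vanish at `t`. -/
def focalSp (Λ : Submodule ℝ (ℝ → V)) (t : ℝ) : Submodule ℝ V :=
  Submodule.span ℝ {x : V | ∃ J ∈ Λ, J t = 0 ∧ deriv J t = x}

theorem focalSp_le_evalSp {Λ 𝒱 : Submodule ℝ (ℝ → V)} {t : ℝ} (h : ∀ X ∈ Λ, X t = 0 → X ∈ 𝒱) :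
    focalSp Λ t ≤ evalSp 𝒱 t :=
  Submodule.span_mono fun _ ⟨J, hJ, h0, hx⟩ => Or.inr ⟨J, h J hJ h0, h0, hx⟩

theorem apply_mem_evalSp {𝒱 : Submodule ℝ (ℝ → V)} {X : ℝ → V} (hX : X ∈ 𝒱) (t : ℝ) :
    X t ∈ evalSp 𝒱 t :=
  Submodule.subset_span (Or.inl ⟨X, hX, rfl⟩)

theorem deriv_mem_evalSp {𝒱 : Submodule ℝ (ℝ → V)} {X : ℝ → V} (hX : X ∈ 𝒱) {t : ℝ}
    (h0 : X t = 0) : deriv X t ∈ evalSp 𝒱 t :=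
  Submodule.subset_span (Or.inr ⟨X, hX, h0, rfl⟩)

theorem evalSp_le_iff {𝒱 : Submodule ℝ (ℝ → V)} {t : ℝ} {U : Submodule ℝ V} :
    evalSp 𝒱 t ≤ U ↔ (∀ X ∈ 𝒱, X t ∈ U) ∧ ∀ X ∈ 𝒱, X t = 0 → deriv X t ∈ U := by
  rw [evalSp, Submodule.span_le, Set.union_subset_iff]
  constructor
  · rintro ⟨h1, h2⟩
    exact ⟨fun X hX => h1 ⟨X, hX, rfl⟩, fun X hX h0 => h2 ⟨X, hX, h0, rfl⟩⟩
  · rintro ⟨h1, h2⟩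
    exact ⟨fun _ ⟨X, hX, h⟩ => h ▸ h1 X hX, fun _ ⟨X, hX, h0, h⟩ => h ▸ h2 X hX h0⟩

theorem eq_and_eq_of_add_eq_add {U : Submodule ℝ V} {x x' y y' : V} (hx : x ∈ Uᗮ)
    (hx' : x' ∈ Uᗮ) (hy : y ∈ U) (hy' : y' ∈ U) (h : x + y = x' + y') : x = x' ∧ y = y' := by
  have h1 : x - x' = y' - y := by rw [sub_eq_sub_iff_add_eq_add, h, add_comm]
  have h2 : x - x' = 0 := Submodule.disjoint_def.1 U.orthogonal_disjoint _
    (h1 ▸ U.sub_mem hy' hy) (Uᗮ.sub_mem hx hx')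
  have h3 : x = x' := sub_eq_zero.1 h2
  subst h3
  exact ⟨rfl, add_left_cancel h⟩

section Lagrangian

variable [FiniteDimensional ℝ V] {R : ℝ → V →L[ℝ] V} {Λ 𝒱 : Submodule ℝ (ℝ → V)}

theorem IsLagrangian.differentiableAt (hΛ : IsLagrangian R Λ) {J : ℝ → V} (hJ : J ∈ Λ) (t : ℝ) :
    DifferentiableAt ℝ J t :=
  ((hΛ.1 J hJ).hasDerivAt t).differentiableAt

theorem IsLagrangian.mem_focalSp (hΛ : IsLagrangian R Λ) {t : ℝ} {x : V} :
    x ∈ focalSp Λ t ↔ ∃ J ∈ Λ, J t = 0 ∧ deriv J t = x := by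
  refine ⟨fun h => ?_, fun h => Submodule.subset_span h⟩
  induction h using Submodule.span_induction with
  | mem x h => exact h
  | zero => exact ⟨0, Λ.zero_mem, rfl, by simp⟩
  | add x y _ _ hx hy =>
    obtain ⟨J, hJ, hJ0, rfl⟩ := hx
    obtain ⟨K, hK, hK0, rfl⟩ := hy
    exact ⟨J + K, Λ.add_mem hJ hK, by simp [hJ0, hK0],
      deriv_add (hΛ.differentiableAt hJ t) (hΛ.differentiableAt hK t)⟩
  | smul c x _ hx =>
    obtain ⟨J, hJ, hJ0, rfl⟩ := hx
    exact ⟨c • J, Λ.smul_mem c hJ, by simp [hJ0],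
      deriv_const_smul c (hΛ.differentiableAt hJ t)⟩

theorem IsLagrangian.apply_mem_focalSp_orthogonal (hΛ : IsLagrangian R Λ) {J : ℝ → V}
    (hJ : J ∈ Λ) (t : ℝ) : J t ∈ (focalSp Λ t)ᗮ := by
  rw [Submodule.mem_orthogonal]
  intro u hu
  obtain ⟨Z, hZ, h0, rfl⟩ := hΛ.mem_focalSp.1 hu
  rw [hΛ.2.2 Z hZ J hJ t, h0, inner_zero_left]

/-- Evaluation at `t` completed by the component of the derivative in `focalSp Λ t`. -/
noncomputable def evalMap (hΛ : IsLagrangian R Λ) (t : ℝ) : Λ →ₗ[ℝ] V where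
  toFun J := J.1 t + (focalSp Λ t).starProjection (deriv J.1 t)
  map_add' J K := by
    simp only [Submodule.coe_add, Pi.add_apply,
      deriv_add (hΛ.differentiableAt J.2 t) (hΛ.differentiableAt K.2 t), map_add]
    abel
  map_smul' c J := by
    simp only [Submodule.coe_smul, Pi.smul_apply,
      deriv_const_smul c (hΛ.differentiableAt J.2 t), map_smul, smul_add, RingHom.id_apply]

theorem evalMap_apply (hΛ : IsLagrangian R Λ) (t : ℝ) (J : Λ) :
    evalMap hΛ t J = J.1 t + (focalSp Λ t).starProjection (deriv J.1 t) := rfl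

theorem evalMap_injective (hR : Continuous R) (hΛ : IsLagrangian R Λ) (t : ℝ) :
    Function.Injective (evalMap hΛ t) := by
  rw [injective_iff_map_eq_zero]
  intro J hJ
  obtain ⟨h1, h2⟩ := eq_and_eq_of_add_eq_add (hΛ.apply_mem_focalSp_orthogonal J.2 t)
    (Submodule.zero_mem _) (Submodule.starProjection_apply_mem _ _) (Submodule.zero_mem _)
    (hJ.trans (add_zero 0).symm)
  rw [Submodule.starProjection_eq_self_iff.2 (hΛ.mem_focalSp.2 ⟨J, J.2, h1, rfl⟩)] at h2
  exact Subtype.ext ((hΛ.1 J J.2).eq_zero hR h1 h2)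

theorem exists_evalMap_inverse (hR : Continuous R) (hΛ : IsLagrangian R Λ) (t : ℝ) :
    ∃ L : V →ₗ[ℝ] (ℝ → V), (∀ v, L v ∈ Λ) ∧
      (∀ K ∈ Λ, ∃ v, L v = K) ∧
      (∀ v ∈ (focalSp Λ t)ᗮ, L v t = v ∧ deriv (L v) t ∈ (focalSp Λ t)ᗮ) ∧
      ∀ v ∈ focalSp Λ t, L v t = 0 ∧ deriv (L v) t = v := by
  have hinj := evalMap_injective hR hΛ t
  have : Module.Finite ℝ Λ := Module.Finite.of_injective _ hinj
  let a := LinearMap.linearEquivOfInjective (evalMap hΛ t) hinj hΛ.2.1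
  have ha : ∀ v, (a.symm v).1 t + (focalSp Λ t).starProjection (deriv (a.symm v).1 t) = v :=
    fun v => a.apply_symm_apply v
  refine ⟨Λ.subtype ∘ₗ a.symm.toLinearMap, fun v => (a.symm v).2, fun K hK =>
    ⟨a ⟨K, hK⟩, by simp⟩, fun v hv => ?_, fun v hv => ?_⟩
  · obtain ⟨h1, h2⟩ := eq_and_eq_of_add_eq_add (hΛ.apply_mem_focalSp_orthogonal (a.symm v).2 t)
      hv (Submodule.starProjection_apply_mem _ _) (Submodule.zero_mem _)
      ((ha v).trans (add_zero v).symm)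
    exact ⟨h1, (Submodule.starProjection_apply_eq_zero_iff _).1 h2⟩
  · obtain ⟨h1, h2⟩ := eq_and_eq_of_add_eq_add (hΛ.apply_mem_focalSp_orthogonal (a.symm v).2 t)
      (Submodule.zero_mem _) (Submodule.starProjection_apply_mem _ _) hv
      ((ha v).trans (zero_add v).symm)
    rw [Submodule.starProjection_eq_self_iff.2
      (hΛ.mem_focalSp.2 ⟨_, (a.symm v).2, h1, rfl⟩)] at h2
    exact ⟨h1, h2⟩

theorem finrank_evalSp (hR : Continuous R) (hΛ : IsLagrangian R Λ) (h𝒱 : 𝒱 ≤ Λ) {t : ℝ}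
    (hfull : ∀ X ∈ Λ, X t = 0 → X ∈ 𝒱) :
    Module.finrank ℝ (evalSp 𝒱 t) = Module.finrank ℝ 𝒱 := by
  have hinj := evalMap_injective hR hΛ t
  have key : evalSp 𝒱 t = LinearMap.range (evalMap hΛ t ∘ₗ Submodule.inclusion h𝒱) := by
    apply le_antisymm
    · rw [evalSp_le_iff]
      refine ⟨fun X hX => ?_, fun X hX h0 => ?_⟩
      · obtain ⟨Z, hZ, h0, hZ'⟩ := hΛ.mem_focalSp.1
          (Submodule.starProjection_apply_mem (focalSp Λ t) (deriv X t))
        have hmem : deriv Z t ∈ focalSp Λ t := hΛ.mem_focalSp.2 ⟨Z, hZ, h0, rfl⟩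
        refine ⟨⟨X - Z, 𝒱.sub_mem hX (hfull Z hZ h0)⟩, ?_⟩
        simp only [LinearMap.comp_apply, evalMap_apply, Submodule.coe_inclusion, Pi.sub_apply,
          deriv_sub (hΛ.differentiableAt (h𝒱 hX) t) (hΛ.differentiableAt hZ t), map_sub,
          Submodule.starProjection_eq_self_iff.2 hmem, h0, ← hZ']
        simp
      · refine ⟨⟨X, hX⟩, ?_⟩
        have hmem : deriv X t ∈ focalSp Λ t := hΛ.mem_focalSp.2 ⟨X, h𝒱 hX, h0, rfl⟩
        simp [evalMap_apply, h0, Submodule.starProjection_eq_self_iff.2 hmem]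
    · rintro _ ⟨X, rfl⟩
      exact (evalSp 𝒱 t).add_mem (apply_mem_evalSp X.2 t)
        (focalSp_le_evalSp hfull (Submodule.starProjection_apply_mem _ _))
  rw [key]
  exact LinearMap.finrank_range_of_inj (hinj.comp (Submodule.inclusion_injective h𝒱))

end Lagrangian

/-- `G` is a moving frame near `a` that carries `evalSp 𝒱 a` to `evalSp 𝒱 t` and, up to vectors of
`evalSp 𝒱 t`, intertwines evaluation and differentiation of the fields in `Λ`. -/
structure IsAdaptedFrame (R : ℝ → V →L[ℝ] V) (Λ 𝒱 : Submodule ℝ (ℝ → V)) (a : ℝ)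
    (G G' : ℝ → V →L[ℝ] V) : Prop where
  self : G a = 1
  hasDerivAt : HasDerivAt G (G' a) a
  hasDerivAt_deriv : ∃ G'', HasDerivAt G' G'' a ∧ ∀ h ∈ (evalSp 𝒱 a)ᗮ, G'' h = -(R a h)
  symm : ∀ x y, ⟪G' a x, y⟫ = ⟪x, G' a y⟫
  exists_field : ∀ h ∈ (evalSp 𝒱 a)ᗮ, ∃ K ∈ Λ, K a = h ∧ deriv K a = G' a h
  evalSp_eq : ∀ᶠ t in 𝓝 a, evalSp 𝒱 t = (evalSp 𝒱 a).map (G t : V →ₗ[ℝ] V)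
  deriv_sub_mem : ∀ t, ∀ K ∈ Λ, ∃ w, G t w = K t ∧ deriv K t - G' t w ∈ evalSp 𝒱 t

theorem dslope_add {Z Z' : ℝ → V} {a : ℝ} (hZ : DifferentiableAt ℝ Z a)
    (hZ' : DifferentiableAt ℝ Z' a) (t : ℝ) :
    dslope (Z + Z') a t = dslope Z a t + dslope Z' a t := by
  rcases eq_or_ne t a with rfl | h
  · simp [deriv_add hZ hZ']
  · simp only [dslope_of_ne _ h, slope, Pi.add_apply, vsub_eq_sub]
    module

theorem dslope_const_smul {Z : ℝ → V} {a : ℝ} (hZ : DifferentiableAt ℝ Z a) (c t : ℝ) :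
    dslope (c • Z) a t = c • dslope Z a t := by
  rcases eq_or_ne t a with rfl | h
  · simp [deriv_const_smul c hZ]
  · simp only [dslope_of_ne _ h, slope, Pi.smul_apply, vsub_eq_sub]
    module

theorem dslope_zero (a t : ℝ) : dslope (0 : ℝ → V) a t = 0 := by
  rcases eq_or_ne t a with rfl | h
  · simp
  · simp [dslope_of_ne _ h, slope]

theorem dslope_mem_evalSp {𝒱 : Submodule ℝ (ℝ → V)} {Z : ℝ → V} (hZ : Z ∈ 𝒱) {a : ℝ}
    (h0 : Z a = 0) (t : ℝ) : dslope Z a t ∈ evalSp 𝒱 t := by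
  rcases eq_or_ne t a with rfl | h
  · rw [dslope_same]
    exact deriv_mem_evalSp hZ h0
  · rw [dslope_of_ne _ h, slope, h0, vsub_eq_sub, sub_zero]
    exact (evalSp 𝒱 t).smul_mem _ (apply_mem_evalSp hZ t)

theorem eventually_isUnit [FiniteDimensional ℝ V] {F : ℝ → V →L[ℝ] V} {a : ℝ}
    (hF : ContinuousAt F a) (h : IsUnit (F a)) : ∀ᶠ t in 𝓝 a, IsUnit (F t) := by
  have : CompleteSpace V := FiniteDimensional.complete ℝ V
  exact hF.eventually (Units.isOpen.mem_nhds h)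

theorem exists_isAdaptedFrame [FiniteDimensional ℝ V] {R : ℝ → V →L[ℝ] V} (hR : Continuous R)
    {Λ 𝒱 : Submodule ℝ (ℝ → V)} (hΛ : IsLagrangian R Λ) (h𝒱 : 𝒱 ≤ Λ) {a : ℝ}
    (hfull : ∀ X ∈ Λ, X a = 0 → X ∈ 𝒱) :
    ∃ G G' : ℝ → V →L[ℝ] V, IsAdaptedFrame R Λ 𝒱 a G G' := by
  obtain ⟨L, hLΛ, hLsurj, hL1, hL2⟩ := exists_evalMap_inverse hR hΛ a
  set U := focalSp Λ a with hU
  have hJ : ∀ v, IsJacobiField R (L v) := fun v => hΛ.1 _ (hLΛ v)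
  have hdiff : ∀ v t, DifferentiableAt ℝ (L v) t := fun v t => ((hJ v).hasDerivAt t).differentiableAt
  set p := Uᗮ.starProjection with hp
  set q := U.starProjection with hq
  have hpm : ∀ v, p v ∈ Uᗮ := fun v => Submodule.starProjection_apply_mem _ _
  have hqm : ∀ v, q v ∈ U := fun v => Submodule.starProjection_apply_mem _ _
  have hpq : ∀ v, p v + q v = v := fun v => by
    rw [add_comm]
    exact Submodule.starProjection_add_starProjection_orthogonal v
  have hpp : ∀ v ∈ Uᗮ, p v = v ∧ q v = 0 := fun v hv =>
    ⟨Submodule.starProjection_eq_self_iff.2 hv,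
      (Submodule.starProjection_apply_eq_zero_iff _).2 hv⟩
  have hqq : ∀ v ∈ U, p v = 0 ∧ q v = v := fun v hv =>
    ⟨(Submodule.starProjection_apply_eq_zero_iff _).2
      (U.le_orthogonal_orthogonal hv), Submodule.starProjection_eq_self_iff.2 hv⟩
  have hZ0 : ∀ v, L (q v) a = 0 := fun v => (hL2 _ (hqm v)).1
  have hZ2 : ∀ v, deriv (deriv (L (q v))) a = 0 := fun v => by
    rw [(hJ _).2 a, hZ0, map_zero, neg_zero]
  have hZ𝒱 : ∀ v, L (q v) ∈ 𝒱 := fun v => hfull _ (hLΛ _) (hZ0 v)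
  let G : ℝ → V →L[ℝ] V := fun t => LinearMap.toContinuousLinearMap
    { toFun := fun v => L (p v) t + dslope (L (q v)) a t
      map_add' := fun v w => by
        simp only [map_add, Pi.add_apply, dslope_add (hdiff _ a) (hdiff _ a)]
        abel
      map_smul' := fun c v => by
        simp only [map_smul, Pi.smul_apply, dslope_const_smul (hdiff _ a), smul_add,
          RingHom.id_apply] }
  have hG : ∀ t v, G t v = L (p v) t + dslope (L (q v)) a t := fun _ _ => rfl
  let G' : ℝ → V →L[ℝ] V := fun t => LinearMap.toContinuousLinearMap
    { toFun := fun v => deriv (L (p v)) t + dslopeDeriv (L (q v)) a t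
      map_add' := fun v w => by
        simp only [map_add, dslopeDeriv, dslope_add (hdiff _ a) (hdiff _ a),
          deriv_add (hdiff _ t) (hdiff _ t)]
        module
      map_smul' := fun c v => by
        simp only [map_smul, dslopeDeriv, dslope_const_smul (hdiff _ a),
          deriv_const_smul c (hdiff _ t), RingHom.id_apply]
        module }
  have hG' : ∀ t v, G' t v = deriv (L (p v)) t + dslopeDeriv (L (q v)) a t := fun _ _ => rfl
  have hG'a : ∀ v, G' a v = deriv (L (p v)) a := fun v => by simp [hG', dslopeDeriv]
  have hself : G a = 1 := by
    ext v
    rw [hG, dslope_same, (hL1 _ (hpm v)).1, (hL2 _ (hqm v)).2, hpq]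
    rfl
  have hder : HasDerivAt G (G' a) a := hasDerivAt_clm_of_apply fun v => by
    rw [hG'a, ← add_zero (deriv _ a)]
    exact ((hJ (p v)).hasDerivAt a).add
      (hasDerivAt_dslope_self (hJ (q v)).1 (hZ0 v) (hZ2 v))
  have hGp : ∀ t w, G t (p w) = L (p w) t := fun t w => by
    simp [hG, hpp _ (hpm w), dslope_zero]
  have hGq : ∀ t w, G t (q w) = dslope (L (q w)) a t := fun t w => by
    simp [hG, hqq _ (hqm w)]
  have hG'p : ∀ t w, G' t (p w) = deriv (L (p w)) t := fun t w => by
    simp [hG', hpp _ (hpm w), dslopeDeriv, dslope_zero]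
  have hG'q : ∀ t w, G' t (q w) = dslopeDeriv (L (q w)) a t := fun t w => by
    simp [hG', hqq _ (hqm w)]
  have hLadd : ∀ w, L w = L (p w) + L (q w) := fun w => by rw [← map_add, hpq]
  have hcomb : ∀ t w, G t (p w + (t - a) • q w) = L w t := fun t w => by
    rw [map_add, map_smul, hGp, hGq, sub_smul_dslope_of_zero (hZ0 w), hLadd w, Pi.add_apply]
  have hUle : U ≤ evalSp 𝒱 a := focalSp_le_evalSp hfull
  have hperp : ∀ h ∈ (evalSp 𝒱 a)ᗮ, h ∈ Uᗮ := fun h hh => Submodule.orthogonal_le hUle hh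
  have hLp : ∀ w, L w ∈ 𝒱 → L (p w) ∈ 𝒱 := fun w hw => by
    rw [← add_sub_cancel_right (L (p w)) (L (q w)), ← hLadd]
    exact 𝒱.sub_mem hw (hZ𝒱 w)
  have hLpa : ∀ w, L (p w) a = p w := fun w => (hL1 _ (hpm w)).1
  refine ⟨G, G', hself, hder, ?_, ?_, ?_, ?_, ?_⟩
  · have hd : DifferentiableAt ℝ G' a := differentiableAt_clm_of_apply fun v => by
      simp only [hG']
      exact ((hJ (p v)).hasDerivAt_deriv a).differentiableAt.add
        (differentiableAt_dslopeDeriv (hJ (q v)).1 (hZ0 v) (hZ2 v))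
    refine ⟨deriv G' a, hd.hasDerivAt, fun h hh => ?_⟩
    have hph := (hpp h (hperp h hh)).1
    have h1 : (fun t => G' t h) = deriv (L h) := funext fun t => by
      conv_lhs => rw [← hph]
      rw [hG'p, hph]
    have h2 := hd.hasDerivAt.clm_apply (hasDerivAt_const a h)
    rw [h1] at h2
    have h3 := h2.unique ((hJ h).hasDerivAt_deriv a)
    rw [map_zero, add_zero] at h3
    rw [h3, ← hph, hLpa]
  · have hin : ∀ x y, ⟪G' a x, y⟫ = ⟪deriv (L (p x)) a, L (p y) a⟫ := fun x y => by
      conv_lhs => rw [← hpq y]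
      rw [inner_add_right, hG'a, hLpa, Submodule.inner_left_of_mem_orthogonal (hqm y)
        (hL1 _ (hpm x)).2, add_zero]
    intro x y
    rw [hin, hΛ.2.2 _ (hLΛ _) _ (hLΛ _), real_inner_comm, ← hin, real_inner_comm]
  · intro h hh
    refine ⟨L h, hLΛ h, (hL1 h (hperp h hh)).1, ?_⟩
    rw [hG'a, (hpp h (hperp h hh)).1]
  · filter_upwards [eventually_isUnit hder.continuousAt (hself ▸ isUnit_one)] with t ht
    apply le_antisymm
    · rcases eq_or_ne t a with rfl | hne
      · intro x hx
        exact ⟨x, hx, by simp [hself]⟩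
      rw [evalSp_le_iff]
      refine ⟨fun X hX => ?_, fun X hX h0 => ?_⟩
      · obtain ⟨w, rfl⟩ := hLsurj X (h𝒱 hX)
        refine ⟨p w + (t - a) • q w, (evalSp 𝒱 a).add_mem ?_
          ((evalSp 𝒱 a).smul_mem _ (hUle (hqm w))), hcomb t w⟩
        exact hLpa w ▸ apply_mem_evalSp (hLp w hX) a
      · obtain ⟨w, rfl⟩ := hLsurj X (h𝒱 hX)
        obtain ⟨u, hu⟩ := ht
        have hz : p w + (t - a) • q w = 0 := by
          have h1 : (↑u⁻¹ * G t : V →L[ℝ] V) (p w + (t - a) • q w) = 0 := by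
            rw [mul_apply_eq_comp, hcomb, h0, map_zero]
          rwa [← hu, Units.inv_mul, one_apply_eq_self] at h1
        obtain ⟨h1, h2⟩ := eq_and_eq_of_add_eq_add (hpm w) (Submodule.zero_mem _)
          (U.smul_mem _ (hqm w)) (Submodule.zero_mem _) (hz.trans (add_zero 0).symm)
        have h3 : q w = 0 := (smul_eq_zero.1 h2).resolve_left (sub_ne_zero.2 hne)
        rw [hLadd w, h1, h3]
        simp
    · rw [Submodule.map_le_iff_le_comap, evalSp_le_iff]
      refine ⟨fun X hX => ?_, fun X hX h0 => ?_⟩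
      · obtain ⟨w, rfl⟩ := hLsurj X (h𝒱 hX)
        have h1 : L w a = p w := by
          rw [hLadd w, Pi.add_apply, hZ0, hLpa, add_zero]
        rw [Submodule.mem_comap, h1]
        exact (hGp t w).symm ▸ apply_mem_evalSp (hLp w hX) t
      · have hmem : deriv X a ∈ U := hΛ.mem_focalSp.2 ⟨X, h𝒱 hX, h0, rfl⟩
        rw [Submodule.mem_comap, ← (hqq _ hmem).2]
        exact (hGq t _).symm ▸ dslope_mem_evalSp (hZ𝒱 _) (hZ0 _) t
  · intro t K hK
    obtain ⟨w, rfl⟩ := hLsurj K hK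
    refine ⟨p w + (t - a) • q w, hcomb t w, ?_⟩
    have h1 : deriv (L w) t = deriv (L (p w)) t + deriv (L (q w)) t := by
      conv_lhs => rw [hLadd w]
      exact deriv_add (hdiff _ t) (hdiff _ t)
    have h2 : deriv (L w) t - G' t (p w + (t - a) • q w) = dslope (L (q w)) a t := by
      rw [map_add, map_smul, hG'p, hG'q, h1, dslopeDeriv]
      rcases eq_or_ne t a with rfl | hne
      · simp
      · rw [smul_inv_smul₀ (sub_ne_zero.2 hne)]
        abel
    rw [h2]
    exact dslope_mem_evalSp (hZ𝒱 w) (hZ0 w) t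

section ProjectionDerivative

variable {A : Type*} [NormedRing A] [NormedAlgebra ℝ A] [CompleteSpace A] [StarRing A]
  [StarModule ℝ A] [ContinuousStar A]

theorem differentiableAt_of_moving_projection {P G : ℝ → A} {a : ℝ} (hG : DifferentiableAt ℝ G a)
    (hGa : G a = 1) (hPs : ∀ t, star (P t) = P t)
    (h1 : ∀ᶠ t in 𝓝 a, P t * G t * (1 - P a) = 0)
    (h2 : ∀ᶠ t in 𝓝 a, P a * Ring.inverse (G t) * (1 - P t) = 0) :
    DifferentiableAt ℝ P a := by
  have hu : ∀ᶠ t in 𝓝 a, IsUnit (G t) :=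
    hG.continuousAt.eventually (Units.isOpen.mem_nhds (hGa ▸ isUnit_one))
  have hinv : DifferentiableAt ℝ (fun t => Ring.inverse (G t)) a :=
    hG.inverse (hGa ▸ isUnit_one)
  let E : ℝ → A := fun t => star (Ring.inverse (G t)) * P a * star (G t)
  have hE : DifferentiableAt ℝ E a := (hinv.star.mul_const (P a)).mul hG.star
  have hEa : E a = P a := by simp [E, hGa]
  let B : ℝ → A := fun t => 1 + E t - star (E t)
  have hB : DifferentiableAt ℝ B a := (hE.const_add 1).sub hE.star
  have hBa : B a = 1 := by simp [B, hEa, hPs]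
  have hBu : ∀ᶠ t in 𝓝 a, IsUnit (B t) :=
    hB.continuousAt.eventually (Units.isOpen.mem_nhds (hBa ▸ isUnit_one))
  have key : P =ᶠ[𝓝 a] fun t => E t * Ring.inverse (B t) := by
    filter_upwards [hu, hBu, h1, h2] with t htu htB ht1 ht2
    have e1 : P t * E t = E t := by
      have := congrArg star ht2
      simp only [star_mul, star_sub, star_one, hPs, star_zero] at this
      rw [sub_mul, one_mul, sub_eq_zero] at this
      simp only [E, ← mul_assoc] at this ⊢
      rw [← this]
    have e2 : E t * P t = P t := by
      have h3 : P t * G t * P a = P t * G t := by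
        rw [mul_sub, mul_one, sub_eq_zero] at ht1
        exact ht1.symm
      have h4 := congrArg star h3
      simp only [star_mul, hPs] at h4
      have h5 : star (Ring.inverse (G t)) * star (G t) = 1 := by
        rw [← star_mul, Ring.mul_inverse_cancel _ htu, star_one]
      simp only [E, mul_assoc]
      rw [h4, ← mul_assoc, h5, one_mul]
    have e3 : P t * star (E t) = P t := by
      have := congrArg star e2
      rwa [star_mul, hPs] at this
    have e4 : P t * B t = E t := by
      simp only [B, mul_sub, mul_add, mul_one, e1, e3]
      abel
    rw [← e4, mul_assoc, Ring.mul_inverse_cancel _ htB, mul_one]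
  exact (hE.mul (hB.inverse (hBa ▸ isUnit_one))).congr_of_eventuallyEq key

theorem hasDerivAt_of_moving_projection {P G : ℝ → A} {S : A} {a : ℝ} (hG : HasDerivAt G S a)
    (hGa : G a = 1) (hS : star S = S) (hP : ∀ t, P t * P t = P t) (hPs : ∀ t, star (P t) = P t)
    (h1 : ∀ᶠ t in 𝓝 a, P t * G t * (1 - P a) = 0)
    (h2 : ∀ᶠ t in 𝓝 a, P a * Ring.inverse (G t) * (1 - P t) = 0) :
    HasDerivAt P (-(P a * S * (1 - P a) + (1 - P a) * S * P a)) a := by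
  have hd := (differentiableAt_of_moving_projection hG.differentiableAt hGa hPs h1 h2).hasDerivAt
  set D := deriv P a
  have e1 : D * P a + P a * D = D := by
    have := hd.mul hd
    rw [show P * P = P from funext hP] at this
    exact this.unique hd
  have e2 : star D = D := by
    have := hd.star
    rw [show (fun t => star (P t)) = P from funext hPs] at this
    exact this.unique hd
  have e3 : D * (1 - P a) + P a * S * (1 - P a) = 0 := by
    have := (hd.mul hG).mul_const (1 - P a)
    have h0 := (hasDerivAt_const a (0 : A)).congr_of_eventuallyEq h1
    have := this.unique h0
    rwa [hGa, mul_one, add_mul] at this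
  have e4 : (1 - P a) * D + (1 - P a) * S * P a = 0 := by
    have := congrArg star e3
    simpa only [star_add, star_mul, star_sub, star_one, hPs, e2, hS, star_zero, mul_assoc] using this
  have e5 : D = D * (1 - P a) + (1 - P a) * D := by
    calc D = D + D - (D * P a + P a * D) := by rw [e1]; abel
      _ = _ := by noncomm_ring
  rw [eq_neg_of_add_eq_zero_left e3, eq_neg_of_add_eq_zero_left e4, ← neg_add] at e5
  exact e5 ▸ hd

end ProjectionDerivative

theorem IsAdaptedFrame.hasDerivAt_starProjection [FiniteDimensional ℝ V] {R : ℝ → V →L[ℝ] V}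
    {Λ 𝒱 : Submodule ℝ (ℝ → V)} {a : ℝ} {G G' : ℝ → V →L[ℝ] V}
    (h : IsAdaptedFrame R Λ 𝒱 a G G') {P : ℝ → V →L[ℝ] V}
    (hP : ∀ t, P t = (evalSp 𝒱 t)ᗮ.starProjection) :
    HasDerivAt P (-(P a * G' a * (1 - P a) + (1 - P a) * G' a * P a)) a := by
  have : CompleteSpace V := FiniteDimensional.complete ℝ V
  have hQ : ∀ t, 1 - P t = (evalSp 𝒱 t).starProjection := fun t => by
    rw [hP, Submodule.starProjection_orthogonal']
    abel
  have hPz : ∀ t, ∀ v ∈ evalSp 𝒱 t, P t v = 0 := fun t v hv => by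
    rw [hP]
    exact (Submodule.starProjection_apply_eq_zero_iff _).2 (Submodule.le_orthogonal_orthogonal _ hv)
  refine hasDerivAt_of_moving_projection h.hasDerivAt h.self ?_ ?_ ?_ ?_ ?_
  · exact IsSelfAdjoint.star_eq (ContinuousLinearMap.isSelfAdjoint_iff_isSymmetric.2 h.symm)
  · intro t
    rw [hP]
    exact Submodule.isIdempotentElem_starProjection _
  · intro t
    rw [hP]
    exact (isSelfAdjoint_starProjection _).star_eq
  · filter_upwards [h.evalSp_eq] with t ht
    ext v
    rw [hQ, mul_apply_eq_comp, mul_apply_eq_comp]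
    refine hPz t _ ?_
    rw [ht]
    exact ⟨_, Submodule.starProjection_apply_mem _ v, rfl⟩
  · filter_upwards [h.evalSp_eq, eventually_isUnit h.hasDerivAt.continuousAt (h.self ▸ isUnit_one)]
      with t ht htu
    ext v
    rw [hQ, mul_apply_eq_comp, mul_apply_eq_comp]
    refine hPz a _ ?_
    obtain ⟨w, hw, hw'⟩ := ht.le (Submodule.starProjection_apply_mem (evalSp 𝒱 t) v)
    have : (Ring.inverse (G t) * G t) w = w := by rw [Ring.inverse_mul_cancel _ htu]; rfl
    rw [← hw']
    exact this.symm ▸ hw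

section Trace

variable [FiniteDimensional ℝ V]

/-- The trace of continuous endomorphisms, as a continuous linear functional. -/
noncomputable def opTrace : (V →L[ℝ] V) →L[ℝ] ℝ :=
  LinearMap.toContinuousLinearMap (LinearMap.trace ℝ V ∘ₗ ContinuousLinearMap.coeLM ℝ)

theorem opTrace_apply (A : V →L[ℝ] V) : opTrace A = LinearMap.trace ℝ V (A : V →ₗ[ℝ] V) := rfl

theorem opTrace_mul_comm (A B : V →L[ℝ] V) : opTrace (A * B) = opTrace (B * A) :=
  LinearMap.trace_mul_comm ℝ (A : V →ₗ[ℝ] V) (B : V →ₗ[ℝ] V)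

theorem opTrace_mul_cycle (A B C : V →L[ℝ] V) : opTrace (A * B * C) = opTrace (C * A * B) := by
  rw [opTrace_mul_comm, mul_assoc]

theorem opTrace_eq_sum_inner {ι : Type*} [Fintype ι] (b : OrthonormalBasis ι ℝ V)
    (A : V →L[ℝ] V) : opTrace A = ∑ i, ⟪b i, A (b i)⟫ :=
  LinearMap.trace_eq_sum_inner _ b

theorem opTrace_star_mul_self [CompleteSpace V] {ι : Type*} [Fintype ι]
    (b : OrthonormalBasis ι ℝ V) (A : V →L[ℝ] V) :
    opTrace (star A * A) = ∑ i, ‖A (b i)‖ ^ 2 := by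
  rw [opTrace_eq_sum_inner b]
  refine Finset.sum_congr rfl fun i _ => ?_
  rw [mul_apply_eq_comp, ContinuousLinearMap.star_eq_adjoint,
    ContinuousLinearMap.adjoint_inner_right, real_inner_self_eq_norm_sq]

theorem opTrace_star_mul_self_nonneg [CompleteSpace V] (A : V →L[ℝ] V) :
    0 ≤ opTrace (star A * A) := by
  rw [opTrace_star_mul_self (stdOrthonormalBasis ℝ V)]
  positivity

theorem eq_zero_of_opTrace_star_mul_self [CompleteSpace V] {A : V →L[ℝ] V}
    (h : opTrace (star A * A) = 0) : A = 0 := by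
  rw [opTrace_star_mul_self (stdOrthonormalBasis ℝ V),
    Finset.sum_eq_zero_iff_of_nonneg fun _ _ => sq_nonneg _] at h
  refine ContinuousLinearMap.coe_injective ((stdOrthonormalBasis ℝ V).toBasis.ext fun i => ?_)
  simpa using h i (Finset.mem_univ i)

theorem opTrace_mul_starProjection {ι : Type*} [Fintype ι] {x : ι → V} (hx : Orthonormal ℝ x)
    {H : Submodule ℝ V} (hH : Submodule.span ℝ (Set.range x) = H) (A : V →L[ℝ] V) :
    opTrace (A * H.starProjection) = ∑ i, ⟪A (x i), x i⟫ := by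
  classical
  have hxH : ∀ i, x i ∈ H := fun i => hH ▸ Submodule.subset_span ⟨i, rfl⟩
  have h1 : H.starProjection = ∑ i, InnerProductSpace.rankOne ℝ (x i) (x i) := by
    ext v
    rw [sum_apply]
    refine Submodule.eq_starProjection_of_mem_of_inner_eq_zero
      (H.sum_mem fun i _ => ?_) fun w hw => ?_
    · exact H.smul_mem _ (hxH i)
    · rw [← hH] at hw
      induction hw using Submodule.span_induction with
      | mem w hw =>
        obtain ⟨j, rfl⟩ := hw
        simp [inner_sub_left, sum_inner, InnerProductSpace.rankOne_apply, inner_smul_left,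
          orthonormal_iff_ite.1 hx, real_inner_comm]
      | zero => simp
      | add a b _ _ ha hb => rw [inner_add_right, ha, hb, add_zero]
      | smul c a _ ha => rw [inner_smul_right, ha, mul_zero]
  rw [h1, Finset.mul_sum, map_sum]
  refine Finset.sum_congr rfl fun i _ => ?_
  have h2 : A * InnerProductSpace.rankOne ℝ (x i) (x i) =
      InnerProductSpace.rankOne ℝ (A (x i)) (x i) := by
    ext v
    simp [InnerProductSpace.rankOne_apply]
  rw [h2, opTrace_apply, InnerProductSpace.trace_rankOne, real_inner_comm]

end Trace

section Riccati

variable [FiniteDimensional ℝ V] {R : ℝ → V →L[ℝ] V} {Λ 𝒱 : Submodule ℝ (ℝ → V)}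
  {P : ℝ → V →L[ℝ] V}

theorem opTrace_compression_congr {t : ℝ} {S B : V →L[ℝ] V}
    (hP : ∀ t, P t = (evalSp 𝒱 t)ᗮ.starProjection)
    (hS : ∀ h ∈ (evalSp 𝒱 t)ᗮ, ∃ K ∈ Λ, K t = h ∧ deriv K t = S h)
    (hB : ∀ K ∈ Λ, deriv K t - B (K t) ∈ evalSp 𝒱 t) :
    opTrace (P t * S) = opTrace (P t * B) := by
  have hPP : P t * P t = P t := by
    rw [hP]
    exact Submodule.isIdempotentElem_starProjection _
  have key : P t * S * P t = P t * B * P t := by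
    ext v
    obtain ⟨K, hK, h1, h2⟩ := hS (P t v) (hP t ▸ Submodule.starProjection_apply_mem _ v)
    have h3 := hB K hK
    rw [h1, h2] at h3
    simp only [mul_apply_eq_comp]
    rw [← sub_eq_zero, ← map_sub, hP t, Submodule.starProjection_apply_eq_zero_iff]
    exact Submodule.le_orthogonal_orthogonal _ (hP t ▸ h3)
  have hc : ∀ C : V →L[ℝ] V, opTrace (P t * C) = opTrace (P t * C * P t) := fun C => by
    rw [opTrace_mul_cycle, hPP]
  rw [hc, key, ← hc]

namespace IsAdaptedFrame

variable {a : ℝ} {G G' : ℝ → V →L[ℝ] V}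

theorem hasDerivAt_opTrace (h : IsAdaptedFrame R Λ 𝒱 a G G')
    (hP : ∀ t, P t = (evalSp 𝒱 t)ᗮ.starProjection) :
    HasDerivAt (fun t => opTrace (P t * (G' t * Ring.inverse (G t))))
      (-(2 * opTrace (P a * G' a * (1 - P a) * G' a)) - opTrace (P a * G' a * G' a)
        - opTrace (P a * R a)) a := by
  have : CompleteSpace V := FiniteDimensional.complete ℝ V
  obtain ⟨G'', h1, h2⟩ := h.hasDerivAt_deriv
  have hinv : HasDerivAt (fun t => Ring.inverse (G t)) (-(G' a)) a := by
    have hf := hasFDerivAt_ringInverse (𝕜 := ℝ) (1 : (V →L[ℝ] V)ˣ)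
    rw [Units.val_one, ← h.self] at hf
    simpa using! hf.comp_hasDerivAt a h.hasDerivAt
  have hd := opTrace.hasFDerivAt.comp_hasDerivAt a
    ((h.hasDerivAt_starProjection hP).mul (h1.mul hinv))
  refine hd.congr_deriv ?_
  have e1 : opTrace (P a * G'') = -opTrace (P a * R a) := by
    rw [opTrace_mul_comm, opTrace_mul_comm (P a), ← map_neg]
    congr 1
    ext v
    simp only [mul_apply_eq_comp, neg_apply]
    exact h2 _ (hP a ▸ Submodule.starProjection_apply_mem _ v)
  have e2 : opTrace ((1 - P a) * G' a * P a * G' a) = opTrace (P a * G' a * (1 - P a) * G' a) := by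
    rw [mul_assoc, opTrace_mul_comm, ← mul_assoc]
  rw [Pi.mul_apply, h.self, Ring.inverse_one]
  simp only [mul_one, mul_add, mul_neg, neg_mul, add_mul, map_add, map_neg, e1, e2,
    ← mul_assoc]
  ring

theorem hasDerivWithinAt_opTrace (h : IsAdaptedFrame R Λ 𝒱 a G G')
    (hP : ∀ t, P t = (evalSp 𝒱 t)ᗮ.starProjection) {s : Set ℝ} (has : a ∈ s)
    {S : ℝ → V →L[ℝ] V} (hSa : S a = G' a)
    (hS : ∀ t ∈ s, ∀ h ∈ (evalSp 𝒱 t)ᗮ, ∃ K ∈ Λ, K t = h ∧ deriv K t = S t h) :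
    HasDerivWithinAt (fun t => opTrace (P t * S t))
      (-(2 * opTrace (P a * S a * (1 - P a) * S a)) - opTrace (P a * S a * S a)
        - opTrace (P a * R a)) s a := by
  have hB : ∀ᶠ t in 𝓝 a, ∀ K ∈ Λ,
      deriv K t - (G' t * Ring.inverse (G t)) (K t) ∈ evalSp 𝒱 t := by
    filter_upwards [eventually_isUnit h.hasDerivAt.continuousAt (h.self ▸ isUnit_one)] with t ht
    intro K hK
    obtain ⟨w, h1, h2⟩ := h.deriv_sub_mem t K hK
    have h3 : (Ring.inverse (G t) * G t) w = w := by rw [Ring.inverse_mul_cancel _ ht]; rfl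
    rw [mul_apply_eq_comp] at h3
    rwa [← h1, mul_apply_eq_comp, h3]
  have key : ∀ᶠ t in 𝓝[s] a,
      opTrace (P t * S t) = opTrace (P t * (G' t * Ring.inverse (G t))) := by
    filter_upwards [self_mem_nhdsWithin, nhdsWithin_le_nhds hB] with t hts htB
    exact opTrace_compression_congr hP (hS t hts) htB
  rw [hSa]
  exact (h.hasDerivAt_opTrace hP).hasDerivWithinAt.congr_of_eventuallyEq key
    (key.self_of_nhdsWithin has)

end IsAdaptedFrame

end Riccati

theorem orthonormal_update {ι : Type*} [DecidableEq ι] {x : ι → V} (hx : Orthonormal ℝ x) (i : ι)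
    {y : V} (hy : ‖y‖ = 1) (hxy : ∀ j, j ≠ i → ⟪x j, y⟫ = 0) :
    Orthonormal ℝ (Function.update x i y) := by
  refine ⟨fun j => ?_, fun j l hjl => ?_⟩
  · rcases eq_or_ne j i with rfl | h
    · simpa
    · simpa [h] using hx.1 j
  · rcases eq_or_ne j i with rfl | h
    · simpa [hjl.symm, real_inner_comm] using hxy l hjl.symm
    · rcases eq_or_ne l i with rfl | h'
      · simpa [h] using hxy j h
      · simpa [h, h'] using hx.2 hjl

theorem inner_apply_eq_zero_of_sum_minimal {ι : Type*} [Fintype ι] {T : V →L[ℝ] V}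
    (hT : ∀ x y, ⟪T x, y⟫ = ⟪x, T y⟫) {m : ℝ}
    (hm : ∀ e : ι → V, Orthonormal ℝ e → m ≤ ∑ i, ⟪T (e i), e i⟫) {x : ι → V}
    (hx : Orthonormal ℝ x) (hxm : ∑ i, ⟪T (x i), x i⟫ = m) {q : V} (hq : ∀ i, ⟪x i, q⟫ = 0)
    (i : ι) : ⟪T (x i), q⟫ = 0 := by
  classical
  have hquad : ∀ ε : ℝ, 0 ≤ (⟪T q, q⟫ - ⟪T (x i), x i⟫ * ‖q‖ ^ 2) * (ε * ε) +
      2 * ⟪T (x i), q⟫ * ε + 0 := by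
    intro ε
    have hpos : 0 < 1 + ε ^ 2 * ‖q‖ ^ 2 := by positivity
    have hn : ‖x i + ε • q‖ ^ 2 = 1 + ε ^ 2 * ‖q‖ ^ 2 := by
      rw [norm_add_sq_real, inner_smul_right, hq, norm_smul, hx.1, mul_pow, Real.norm_eq_abs,
        sq_abs]
      ring
    have hne : ‖x i + ε • q‖ ≠ 0 := fun h0 => by
      rw [h0] at hn
      norm_num at hn
      linarith
    set r := ‖x i + ε • q‖⁻¹ with hr
    have hr2 : r ^ 2 * (1 + ε ^ 2 * ‖q‖ ^ 2) = 1 := by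
      rw [← hn, hr, ← mul_pow, inv_mul_cancel₀ hne, one_pow]
    have hON : Orthonormal ℝ (Function.update x i (r • (x i + ε • q))) := by
      refine orthonormal_update hx i ?_ fun j hj => ?_
      · rw [norm_smul, hr, norm_inv, norm_norm, inv_mul_cancel₀ hne]
      · rw [inner_smul_right, inner_add_right, hx.2 hj, inner_smul_right, hq]
        ring
    have h1 := hm _ hON
    rw [← hxm, ← Finset.add_sum_erase _ _ (Finset.mem_univ i),
      ← Finset.add_sum_erase (a := i) _ (fun j => ⟪T (Function.update x i _ j), _⟫)
        (Finset.mem_univ i)] at h1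
    have hs : ∑ j ∈ Finset.univ.erase i, ⟪T (Function.update x i (r • (x i + ε • q)) j),
        Function.update x i (r • (x i + ε • q)) j⟫ = ∑ j ∈ Finset.univ.erase i, ⟪T (x j), x j⟫ :=
      Finset.sum_congr rfl fun j hj => by
        rw [Function.update_of_ne (Finset.ne_of_mem_erase hj)]
    rw [hs] at h1
    have h2 := le_of_add_le_add_right h1
    have h3 : ⟪T q, x i⟫ = ⟪T (x i), q⟫ := by rw [hT, real_inner_comm]
    simp only [Function.update_self, map_smul, map_add, inner_smul_left, inner_smul_right,
      inner_add_left, inner_add_right, h3, RCLike.conj_to_real] at h2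
    have h4 := mul_le_mul_of_nonneg_right h2 hpos.le
    linear_combination h4 + (⟪T (x i), x i⟫ + ε * ⟪T (x i), q⟫ + (ε * (⟪T (x i), q⟫ +
      ε * ⟪T q, q⟫))) * hr2
  have := discrim_le_zero hquad
  rw [discrim, mul_zero, sub_zero] at this
  have := pow_eq_zero_iff two_ne_zero |>.1 (le_antisymm this (sq_nonneg _))
  linarith

section Comparison

open Set in
theorem eq_zero_of_deriv_add_mul_nonneg {u g lam : ℝ → ℝ} {a b : ℝ} (hab : a < b)
    (hlam : ContinuousOn lam (Icc a b))
    (hu : ∀ t ∈ Icc a b, HasDerivWithinAt u (g t - lam t * u t) (Icc a b) t)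
    (hg : ∀ t ∈ Icc a b, 0 ≤ g t) (ha : 0 ≤ u a) (hb : u b = 0) : ∀ t ∈ Icc a b, g t = 0 := by
  let L : ℝ → ℝ := IccExtend hab.le ((Icc a b).domRestrict lam)
  have hL : Continuous L := (continuousOn_iff_continuous_domRestrict.1 hlam).Icc_extend'
  have hLe : ∀ t ∈ Icc a b, L t = lam t := fun t ht => IccExtend_of_mem hab.le _ ht
  let M : ℝ → ℝ := fun t => Real.exp (∫ s in a..t, L s)
  have hM : ∀ t ∈ Icc a b, HasDerivWithinAt M (M t * lam t) (Icc a b) t := fun t ht => by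
    rw [← hLe t ht]
    exact (hL.integral_hasStrictDerivAt a t).hasDerivAt.exp.hasDerivWithinAt
  have hM0 : ∀ t, 0 < M t := fun t => Real.exp_pos _
  have hw : ∀ t ∈ Icc a b, HasDerivWithinAt (fun s => M s * u s) (M t * g t) (Icc a b) t :=
    fun t ht => ((hM t ht).mul (hu t ht)).congr_deriv (by ring)
  have hmono : MonotoneOn (fun s => M s * u s) (Icc a b) := by
    refine monotoneOn_of_hasDerivWithinAt_nonneg (convex_Icc a b)
      (fun t ht => (hw t ht).continuousWithinAt)
      (fun t ht => (hw t (interior_subset ht)).mono interior_subset)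
      fun t ht => mul_nonneg (hM0 t).le (hg t (interior_subset ht))
  have hu0 : ∀ t ∈ Icc a b, u t = 0 := fun t ht => by
    have h1 := hmono (left_mem_Icc.2 hab.le) ht ht.1
    have h2 := hmono ht (right_mem_Icc.2 hab.le) ht.2
    simp only [hb, mul_zero] at h1 h2
    have h3 : M t * u t = 0 := le_antisymm h2 ((mul_nonneg (hM0 a).le ha).trans h1)
    exact (mul_eq_zero.1 h3).resolve_left (hM0 t).ne'
  intro t ht
  have h1 : HasDerivWithinAt u 0 (Icc a b) t :=
    (hasDerivWithinAt_const t (Icc a b) (0 : ℝ)).congr hu0 (hu0 t ht)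
  have h2 := (uniqueDiffOn_Icc hab t ht).eq_deriv _ (hu t ht) h1
  rwa [hu0 t ht, mul_zero, sub_zero] at h2

variable [FiniteDimensional ℝ V]

theorem opTrace_riccati_identity [CompleteSpace V] {P S : V →L[ℝ] V} (hP : P * P = P)
    (hPs : star P = P) (hS : star S = S) (c : ℝ) :
    2 * opTrace (P * S * (1 - P) * S) + opTrace (P * S * S) =
      3 * opTrace (star ((1 - P) * S * P) * ((1 - P) * S * P)) +
        opTrace (star (P * S * P - c • P) * (P * S * P - c • P)) +
        2 * c * opTrace (P * S) - c ^ 2 * opTrace P := by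
  have hP' : ∀ X, P * (P * X) = P * X := fun X => by rw [← mul_assoc, hP]
  have hc : ∀ X, opTrace (P * (X * P)) = opTrace (P * X) := fun X => by
    rw [← mul_assoc, opTrace_mul_cycle, hP]
  have h1 := hc (S * S)
  have h2 := hc (S * (P * S))
  have h3 := hc S
  simp only [mul_assoc] at h1 h2 h3
  simp only [star_mul, star_sub, star_smul, hPs, hS, star_trivial, mul_sub, sub_mul,
    mul_one, one_mul, mul_assoc, hP, hP', smul_mul_assoc, mul_smul_comm, map_sub, map_smul, h1, h2,
    h3, smul_eq_mul]
  ring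

theorem trace_rigidity {k : ℕ} {κ : ℝ} {R P S : ℝ → V →L[ℝ] V} {H : ℝ → Submodule ℝ V}
    {lam : ℝ → ℝ} {t₀ t₁ : ℝ} (h01 : t₀ < t₁)
    (hRic : ∀ t, ∀ e : Fin k → V, Orthonormal ℝ e → k * κ ≤ ∑ i, ⟪R t (e i), e i⟫)
    (hlam : ∀ t ∈ Set.Icc t₀ t₁, HasDerivAt lam (-(lam t ^ 2) - κ) t)
    (hP : ∀ t, P t = (H t).starProjection)
    (hH : ∀ t ∈ Set.Icc t₀ t₁, ∃ x : Fin k → V, Orthonormal ℝ x ∧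
      Submodule.span ℝ (Set.range x) = H t)
    (hS : ∀ t ∈ Set.Icc t₀ t₁, ∀ x y, ⟪S t x, y⟫ = ⟪x, S t y⟫)
    (hσ : ∀ t ∈ Set.Icc t₀ t₁, HasDerivWithinAt (fun t => opTrace (P t * S t))
      (-(2 * opTrace (P t * S t * (1 - P t) * S t)) - opTrace (P t * S t * S t)
        - opTrace (P t * R t)) (Set.Icc t₀ t₁) t)
    (h0 : opTrace (P t₀ * S t₀) ≤ k * lam t₀) (h1 : opTrace (P t₁ * S t₁) = k * lam t₁) :
    ∀ t ∈ Set.Icc t₀ t₁, (1 - P t) * S t * P t = 0 ∧ P t * S t * P t = lam t • P t ∧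
      opTrace (P t * R t) = k * κ := by
  have : CompleteSpace V := FiniteDimensional.complete ℝ V
  have hPP : ∀ t, P t * P t = P t := fun t => hP t ▸ Submodule.isIdempotentElem_starProjection _
  have hPs : ∀ t, star (P t) = P t := fun t => hP t ▸ (isSelfAdjoint_starProjection _).star_eq
  have hSs : ∀ t ∈ Set.Icc t₀ t₁, star (S t) = S t := fun t ht =>
    IsSelfAdjoint.star_eq (ContinuousLinearMap.isSelfAdjoint_iff_isSymmetric.2 (hS t ht))
  have htr : ∀ t ∈ Set.Icc t₀ t₁, opTrace (P t) = k := fun t ht => by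
    obtain ⟨x, hx, hxH⟩ := hH t ht
    rw [← one_mul (P t), hP, opTrace_mul_starProjection hx hxH]
    simp [hx.1]
  have hPR : ∀ t ∈ Set.Icc t₀ t₁, k * κ ≤ opTrace (P t * R t) := fun t ht => by
    obtain ⟨x, hx, hxH⟩ := hH t ht
    rw [opTrace_mul_comm, hP, opTrace_mul_starProjection hx hxH]
    exact hRic t x hx
  let A : ℝ → V →L[ℝ] V := fun t => (1 - P t) * S t * P t
  let D : ℝ → V →L[ℝ] V := fun t => P t * S t * P t - lam t • P t
  have hA := fun t => opTrace_star_mul_self_nonneg (A t)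
  have hD := fun t => opTrace_star_mul_self_nonneg (D t)
  have key := eq_zero_of_deriv_add_mul_nonneg (u := fun t => k * lam t - opTrace (P t * S t))
    (g := fun t => 3 * opTrace (star (A t) * A t) + opTrace (star (D t) * D t) +
      (opTrace (P t * R t) - k * κ)) (lam := fun t => 2 * lam t) h01
    (fun t ht => ((hlam t ht).continuousAt.const_mul 2).continuousWithinAt)
    (fun t ht => by
      refine (((hlam t ht).hasDerivWithinAt.const_mul (k : ℝ)).sub (hσ t ht)).congr_deriv ?_
      have := opTrace_riccati_identity (hPP t) (hPs t) (hSs t ht) (lam t)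
      rw [htr t ht] at this
      linear_combination this)
    (fun t ht => by linarith [hA t, hD t, hPR t ht]) (sub_nonneg.2 h0) (sub_eq_zero.2 h1.symm)
  intro t ht
  have h := key t ht
  have hPRt := hPR t ht
  refine ⟨?_, ?_, by linarith [hA t, hD t]⟩
  · exact eq_zero_of_opTrace_star_mul_self (A := A t) (by linarith [hA t, hD t])
  · exact sub_eq_zero.1
      (eq_zero_of_opTrace_star_mul_self (A := D t) (by linarith [hA t, hD t]))

end Comparison

theorem exists_orthonormal_span_eq [FiniteDimensional ℝ V] {H : Submodule ℝ V} {k : ℕ}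
    (hH : Module.finrank ℝ H = k) :
    ∃ x : Fin k → V, Orthonormal ℝ x ∧ Submodule.span ℝ (Set.range x) = H := by
  let b := (stdOrthonormalBasis ℝ H).reindex (finCongr hH)
  refine ⟨fun i => b i, b.orthonormal.comp_linearIsometry H.subtypeₗᵢ, ?_⟩
  have h1 : Set.range (fun i => (b i : V)) = H.subtype '' Set.range b := by
    rw [← Set.range_comp]
    rfl
  rw [h1, ← Submodule.map_span, ← b.coe_toBasis, b.toBasis.span_eq, Submodule.map_top,
    Submodule.range_subtype]

theorem IsAdaptedFrame.deriv_sub_apply_mem {R : ℝ → V →L[ℝ] V}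
    {Λ 𝒱 : Submodule ℝ (ℝ → V)} {a : ℝ} {G G' : ℝ → V →L[ℝ] V}
    (h : IsAdaptedFrame R Λ 𝒱 a G G') {K : ℝ → V} (hK : K ∈ Λ) :
    deriv K a - G' a (K a) ∈ evalSp 𝒱 a := by
  obtain ⟨w, h1, h2⟩ := h.deriv_sub_mem a K hK
  rw [h.self, one_apply_eq_self] at h1
  rwa [← h1]

section Rigidity

variable [FiniteDimensional ℝ V] {R : ℝ → V →L[ℝ] V} {Λ 𝒱 : Submodule ℝ (ℝ → V)}

theorem IsAdaptedFrame.opTrace_eq_sum {ι : Type*} [Fintype ι] {a : ℝ} {G G' : ℝ → V →L[ℝ] V}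
    (h : IsAdaptedFrame R Λ 𝒱 a G G') {x : ι → V} (hx : Orthonormal ℝ x)
    (hxspan : Submodule.span ℝ (Set.range x) = (evalSp 𝒱 a)ᗮ) {K : ι → ℝ → V}
    (hK : ∀ i, K i ∈ Λ) (hKx : ∀ i, K i a = x i) :
    opTrace ((evalSp 𝒱 a)ᗮ.starProjection * G' a) = ∑ i, ⟪deriv (K i) a, x i⟫ := by
  rw [opTrace_mul_comm, opTrace_mul_starProjection hx hxspan]
  refine Finset.sum_congr rfl fun i _ => ?_
  have h1 := Submodule.inner_right_of_mem_orthogonal (h.deriv_sub_apply_mem (hK i))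
    (hxspan ▸ Submodule.subset_span ⟨i, rfl⟩ : x i ∈ (evalSp 𝒱 a)ᗮ)
  rw [hKx, inner_sub_left, sub_eq_zero] at h1
  exact h1.symm

theorem rigidity_of_trace_eq {k : ℕ} {κ : ℝ} (hR : Continuous R)
    (hR_sym : ∀ t, ∀ x y, ⟪R t x, y⟫ = ⟪x, R t y⟫)
    (hRic : ∀ t, ∀ e : Fin k → V, Orthonormal ℝ e → k * κ ≤ ∑ i, ⟪R t (e i), e i⟫)
    (hΛ : IsLagrangian R Λ) (h𝒱 : 𝒱 ≤ Λ) {t₀ t₁ : ℝ} (h01 : t₀ < t₁)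
    (hfull : ∀ t ∈ Set.Icc t₀ t₁, ∀ X ∈ Λ, X t = 0 → X ∈ 𝒱) {lam : ℝ → ℝ}
    (hlam : ∀ t ∈ Set.Icc t₀ t₁, HasDerivAt lam (-(lam t ^ 2) - κ) t)
    {e : Fin k → V} (he : Orthonormal ℝ e)
    (hespan : Submodule.span ℝ (Set.range e) = (evalSp 𝒱 t₀)ᗮ)
    {J : Fin k → ℝ → V} (hJ : ∀ i, J i ∈ Λ) (hJe : ∀ i, J i t₀ = e i)
    (hinit : ∑ i, ⟪deriv (J i) t₀, e i⟫ ≤ k * lam t₀)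
    {x : Fin k → V} (hx : Orthonormal ℝ x)
    (hxspan : Submodule.span ℝ (Set.range x) = (evalSp 𝒱 t₁)ᗮ)
    {K : Fin k → ℝ → V} (hK : ∀ i, K i ∈ Λ) (hKx : ∀ i, K i t₁ = x i)
    (heq : ∑ i, ⟪deriv (K i) t₁, x i⟫ = k * lam t₁) :
    (∀ h ∈ (evalSp 𝒱 t₀)ᗮ, ∃ Y ∈ Λ, Y t₀ = h ∧ deriv Y t₀ = lam t₀ • h) ∧
      ∀ Y ∈ Λ, Y t₀ ∈ (evalSp 𝒱 t₀)ᗮ → deriv Y t₀ = lam t₀ • Y t₀ →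
        ∀ t ∈ Set.Icc t₀ t₁, Y t ∈ (evalSp 𝒱 t)ᗮ ∧ deriv Y t = lam t • Y t := by
  have : CompleteSpace V := FiniteDimensional.complete ℝ V
  have hm0 : t₀ ∈ Set.Icc t₀ t₁ := Set.left_mem_Icc.2 h01.le
  have hm1 : t₁ ∈ Set.Icc t₀ t₁ := Set.right_mem_Icc.2 h01.le
  have hframe : ∀ t, ∃ G G' : ℝ → V →L[ℝ] V, t ∈ Set.Icc t₀ t₁ → IsAdaptedFrame R Λ 𝒱 t G G' :=
    fun t => by
      by_cases ht : t ∈ Set.Icc t₀ t₁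
      · obtain ⟨G, G', h⟩ := exists_isAdaptedFrame hR hΛ h𝒱 (hfull t ht)
        exact ⟨G, G', fun _ => h⟩
      · exact ⟨0, 0, fun h => absurd h ht⟩
  choose G G' hF using hframe
  let S : ℝ → V →L[ℝ] V := fun t => G' t t
  let P : ℝ → V →L[ℝ] V := fun t => (evalSp 𝒱 t)ᗮ.starProjection
  have hP : ∀ t, P t = (evalSp 𝒱 t)ᗮ.starProjection := fun _ => rfl
  have hPz : ∀ t, ∀ v ∈ evalSp 𝒱 t, P t v = 0 := fun t v hv =>
    (Submodule.starProjection_apply_eq_zero_iff _).2 (Submodule.le_orthogonal_orthogonal _ hv)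
  have hPid : ∀ t, ∀ v ∈ (evalSp 𝒱 t)ᗮ, P t v = v := fun t v hv =>
    Submodule.starProjection_eq_self_iff.2 hv
  have hdim : ∀ t ∈ Set.Icc t₀ t₁, Module.finrank ℝ (evalSp 𝒱 t)ᗮ = k := fun t ht => by
    have h1 := (evalSp 𝒱 t).finrank_add_finrank_orthogonal
    have h2 := (evalSp 𝒱 t₁).finrank_add_finrank_orthogonal
    rw [finrank_evalSp hR hΛ h𝒱 (hfull t ht)] at h1
    rw [finrank_evalSp hR hΛ h𝒱 (hfull t₁ hm1), ← hxspan,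
      finrank_span_eq_card hx.linearIndependent, Fintype.card_fin] at h2
    omega
  have hON : ∀ t ∈ Set.Icc t₀ t₁, ∃ x : Fin k → V, Orthonormal ℝ x ∧
      Submodule.span ℝ (Set.range x) = (evalSp 𝒱 t)ᗮ :=
    fun t ht => exists_orthonormal_span_eq (hdim t ht)
  have hrig := trace_rigidity (S := S) h01 hRic hlam hP hON (fun t ht => (hF t ht).symm)
    (fun t ht => (hF t ht).hasDerivWithinAt_opTrace hP ht rfl fun s hs => (hF s hs).exists_field)
    (((hF t₀ hm0).opTrace_eq_sum he hespan hJ hJe).trans_le hinit)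
    (((hF t₁ hm1).opTrace_eq_sum hx hxspan hK hKx).trans heq)
  have hSP : ∀ t ∈ Set.Icc t₀ t₁, ∀ h ∈ (evalSp 𝒱 t)ᗮ, S t h = lam t • h := fun t ht h hh => by
    obtain ⟨h1, h2, -⟩ := hrig t ht
    rw [sub_mul, sub_mul, one_mul, h2, sub_eq_zero] at h1
    simpa [hPid t h hh] using DFunLike.congr_fun h1 h
  refine ⟨fun h hh => ?_, ?_⟩
  · obtain ⟨Y, hY, h1, h2⟩ := (hF t₀ hm0).exists_field h hh
    exact ⟨Y, hY, h1, h2.trans (hSP t₀ hm0 h hh)⟩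
  have hPconst : ∀ t ∈ Set.Icc t₀ t₁, P t = P t₀ := by
    have hd : ∀ t ∈ Set.Icc t₀ t₁, HasDerivAt P 0 t := fun t ht => by
      obtain ⟨h1, -, -⟩ := hrig t ht
      have h2 := congrArg star h1
      have hPs : star (P t) = P t := (isSelfAdjoint_starProjection _).star_eq
      have hSs : star (S t) = S t :=
        IsSelfAdjoint.star_eq (ContinuousLinearMap.isSelfAdjoint_iff_isSymmetric.2 (hF t ht).symm)
      rw [star_mul, star_mul, star_sub, star_one, hPs, hSs, star_zero, ← mul_assoc] at h2
      refine ((hF t ht).hasDerivAt_starProjection hP).congr_deriv ?_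
      rw [h1, h2, add_zero, neg_zero]
    exact constant_of_has_deriv_right_zero
      (fun t ht => (hd t ht).continuousAt.continuousWithinAt)
      fun t ht => (hd t (Set.Ico_subset_Icc_self ht)).hasDerivWithinAt
  have hRP : ∀ t ∈ Set.Icc t₀ t₁, ∀ v, (1 - P t₀) (R t (P t₀ v)) = 0 := fun t ht v => by
    obtain ⟨y, hy, hyspan⟩ := hON t ht
    have hsum : ∑ i, ⟪R t (y i), y i⟫ = k * κ := by
      rw [← (hrig t ht).2.2, opTrace_mul_comm, hP, opTrace_mul_starProjection hy hyspan]
    have hyP : ∀ i, y i ∈ (evalSp 𝒱 t)ᗮ := fun i => hyspan ▸ Submodule.subset_span ⟨i, rfl⟩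
    have hRy : ∀ w ∈ (evalSp 𝒱 t)ᗮ, R t w ∈ (evalSp 𝒱 t)ᗮ := fun w hw => by
      rw [← hyspan] at hw
      induction hw using Submodule.span_induction with
      | mem w hw =>
        obtain ⟨i, rfl⟩ := hw
        rw [Submodule.mem_orthogonal']
        exact fun q hq => inner_apply_eq_zero_of_sum_minimal (hR_sym t) (hRic t) hy hsum
          (fun j => Submodule.inner_left_of_mem_orthogonal hq (hyP j)) i
      | zero => simp
      | add a b _ _ ha hb => exact (map_add (R t) a b).symm ▸ Submodule.add_mem _ ha hb
      | smul c a _ ha => exact (map_smul (R t) c a).symm ▸ Submodule.smul_mem _ c ha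
    rw [← hPconst t ht, sub_apply, one_apply_eq_self, sub_eq_zero]
    exact (hPid t _ (hRy _ (Submodule.starProjection_apply_mem _ v))).symm
  intro Y hY hY0 hY0'
  obtain ⟨C, hC⟩ := exists_norm_le_Icc hR t₀ t₁
  have hYJ := hΛ.1 Y hY
  set Q := 1 - P t₀ with hQ
  have hQY : ∀ v, Q v = v - P t₀ v := fun v => rfl
  have hz := second_order_eq_zero (z := fun t => Q (Y t)) (z' := fun t => Q (deriv Y t))
    (z'' := fun t => Q (-(R t (Y t)))) (a := t₀) (b := t₁) (C := ‖Q‖ * C)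
    (fun t _ => Q.hasFDerivAt.comp_hasDerivAt t (hYJ.hasDerivAt t))
    (fun t _ => Q.hasFDerivAt.comp_hasDerivAt t (hYJ.hasDerivAt_deriv t))
    (fun t ht => by
      have h1 : Q (-(R t (Y t))) = -(Q (R t (Q (Y t)))) := by
        rw [map_neg, hQY (Y t), map_sub, map_sub, hRP t ht, sub_zero]
      rw [h1, norm_neg, mul_assoc]
      exact Q.le_opNorm_of_le ((R t).le_of_opNorm_le (hC t ht) _))
    (by simp only [hQY]; rw [hPid t₀ _ hY0, sub_self])
    (by simp only [hQY]; rw [hY0', map_smul, hPid t₀ _ hY0, sub_self])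
  intro t ht
  obtain ⟨h1, h2⟩ := hz t ht
  have hmem : Y t ∈ (evalSp 𝒱 t)ᗮ := by
    have h3 : P t (Y t) = Y t := by
      rw [hPconst t ht]
      exact (sub_eq_zero.1 h1).symm
    exact Submodule.starProjection_eq_self_iff.1 h3
  refine ⟨hmem, ?_⟩
  have h3 : P t (deriv Y t) = deriv Y t := by
    rw [hPconst t ht]
    exact (sub_eq_zero.1 h2).symm
  have h4 := hPz t _ ((hF t ht).deriv_sub_apply_mem hY)
  rwa [map_sub, h3, hSP t ht _ hmem, map_smul, hPid t _ hmem, sub_eq_zero] at h4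

end Rigidity

open Set in
theorem IsJacobiField.exists_smul_of_deriv_eq {R : ℝ → V →L[ℝ] V} {Y : ℝ → V}
    (hY : IsJacobiField R Y) {κ t₀ t₁ : ℝ} (h01 : t₀ < t₁) {lam : ℝ → ℝ}
    (hlam : ∀ t ∈ Icc t₀ t₁, HasDerivAt lam (-(lam t ^ 2) - κ) t) (h0 : Y t₀ ≠ 0)
    (hd : ∀ t ∈ Icc t₀ t₁, deriv Y t = lam t • Y t) :
    ∃ f : ℝ → ℝ, f t₀ = ‖Y t₀‖ ∧
      (∀ t ∈ Icc t₀ t₁, HasDerivAt f (deriv f t) t) ∧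
      (∀ t ∈ Icc t₀ t₁, HasDerivAt (deriv f) (-(κ * f t)) t) ∧
      ∀ t ∈ Icc t₀ t₁, Y t = f t • (‖Y t₀‖⁻¹ • Y t₀) := by
  set E := ‖Y t₀‖⁻¹ • Y t₀ with hE
  have hn : ‖Y t₀‖ ≠ 0 := norm_ne_zero_iff.2 h0
  let f : ℝ → ℝ := fun t => ⟪Y t, E⟫
  have hft₀ : f t₀ = ‖Y t₀‖ := by
    simp only [f, hE, inner_smul_right, real_inner_self_eq_norm_sq]
    field_simp
  have hf : ∀ t, HasDerivAt f ⟪deriv Y t, E⟫ t := fun t => by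
    simpa using (hY.hasDerivAt t).inner ℝ (hasDerivAt_const t E)
  have hf' : deriv f = fun t => ⟪deriv Y t, E⟫ := funext fun t => (hf t).deriv
  have hf'' : ∀ t, HasDerivAt (deriv f) ⟪-(R t (Y t)), E⟫ t := fun t => by
    rw [hf']
    simpa using (hY.hasDerivAt_deriv t).inner ℝ (hasDerivAt_const t E)
  have hfl : ∀ t ∈ Icc t₀ t₁, deriv f t = lam t * f t := fun t ht => by
    simp only [hf', hd t ht, inner_smul_left, RCLike.conj_to_real, f]
  refine ⟨f, hft₀, fun t _ => (hf t).differentiableAt.hasDerivAt, fun t ht => ?_, ?_⟩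
  · have h1 : HasDerivWithinAt (fun s => lam s * f s)
        ((-(lam t ^ 2) - κ) * f t + lam t * (lam t * f t)) (Icc t₀ t₁) t := by
      rw [← hfl t ht, hf']
      exact ((hlam t ht).mul (hf t)).hasDerivWithinAt
    have h2 := (uniqueDiffOn_Icc h01 t ht).eq_deriv _ (hf'' t).hasDerivWithinAt
      (h1.congr hfl (hfl t ht))
    exact (hf'' t).congr_deriv (h2.trans (by ring))
  · obtain ⟨C, hC⟩ := isCompact_Icc.exists_bound_of_continuousOn (f := lam) (s := Icc t₀ t₁)
      fun t ht => (hlam t ht).continuousAt.continuousWithinAt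
    have hz : ∀ t ∈ Icc t₀ t₁, HasDerivAt (fun s => Y s - f s • E) (lam t • (Y t - f t • E)) t :=
      fun t ht => by
        refine ((hY.hasDerivAt t).sub ((hf t).smul_const E)).congr_deriv ?_
        rw [← congrFun hf' t, hfl t ht, hd t ht, smul_sub, mul_smul]
    have := eq_zero_of_abs_deriv_le_mul_abs_self_of_eq_zero_right (K := C)
      (fun t ht => (hz t ht).continuousAt.continuousWithinAt)
      (fun t ht => (hz t (Ico_subset_Icc_self ht)).hasDerivWithinAt)
      (by rw [hft₀, hE, smul_inv_smul₀ hn, sub_self])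
      (fun t ht => by
        rw [norm_smul]
        exact mul_le_mul_of_nonneg_right (hC t (Ico_subset_Icc_self ht)) (norm_nonneg _))
    exact fun t ht => sub_eq_zero.1 (this t ht)

section Splitting

variable {Λ 𝒱 : Submodule ℝ (ℝ → V)} {W : Submodule ℝ V} {t₀ : ℝ} {ι : Type*} [Fintype ι]
  {e : ι → V} {Y : ι → ℝ → V}

theorem sup_span_range_eq (h𝒱 : ∀ X : ℝ → V, X ∈ 𝒱 ↔ X ∈ Λ ∧ ∀ w ∈ W, ⟪X t₀, w⟫ = 0)
    (he : Orthonormal ℝ e) (hespan : Submodule.span ℝ (Set.range e) = W) (hY : ∀ i, Y i ∈ Λ)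
    (hYe : ∀ i, Y i t₀ = e i) : 𝒱 ⊔ Submodule.span ℝ (Set.range Y) = Λ := by
  refine le_antisymm (sup_le (fun X hX => ((h𝒱 X).1 hX).1)
    (Submodule.span_le.2 (Set.range_subset_iff.2 hY))) fun X hX => ?_
  have hmem : ∑ i, ⟪X t₀, e i⟫ • Y i ∈ Submodule.span ℝ (Set.range Y) :=
    Submodule.sum_mem _ fun i _ => Submodule.smul_mem _ _ (Submodule.subset_span ⟨i, rfl⟩)
  refine Submodule.mem_sup.2 ⟨X - ∑ i, ⟪X t₀, e i⟫ • Y i, (h𝒱 _).2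
    ⟨Λ.sub_mem hX (Λ.sum_mem fun i _ => Λ.smul_mem _ (hY i)), fun w hw => ?_⟩, _, hmem,
    sub_add_cancel _ _⟩
  rw [← hespan] at hw
  simp only [Pi.sub_apply, Finset.sum_apply, Pi.smul_apply, hYe]
  induction hw using Submodule.span_induction with
  | mem w hw =>
    obtain ⟨j, rfl⟩ := hw
    rw [inner_sub_left, he.inner_left_fintype]
    simp
  | zero => simp
  | add a b _ _ ha hb => rw [inner_add_right, ha, hb, add_zero]
  | smul c a _ ha => rw [inner_smul_right, ha, mul_zero]

theorem eq_zero_of_mem_span_range (he : Orthonormal ℝ e) (hYe : ∀ i, Y i t₀ = e i) {X : ℝ → V}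
    (hX : X ∈ Submodule.span ℝ (Set.range Y)) (h0 : ∀ i, ⟪e i, X t₀⟫ = 0) : X = 0 := by
  obtain ⟨c, rfl⟩ := (Submodule.mem_span_range_iff_exists_fun ℝ).1 hX
  refine Finset.sum_eq_zero fun i _ => ?_
  have := h0 i
  simp only [Finset.sum_apply, Pi.smul_apply, hYe] at this
  rw [he.inner_right_fintype] at this
  rw [this, zero_smul]

theorem inf_span_range_eq_bot (h𝒱 : ∀ X : ℝ → V, X ∈ 𝒱 ↔ X ∈ Λ ∧ ∀ w ∈ W, ⟪X t₀, w⟫ = 0)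
    (he : Orthonormal ℝ e) (heW : ∀ i, e i ∈ W) (hYe : ∀ i, Y i t₀ = e i) :
    𝒱 ⊓ Submodule.span ℝ (Set.range Y) = ⊥ :=
  (Submodule.eq_bot_iff _).2 fun X ⟨hX, hX'⟩ => eq_zero_of_mem_span_range he hYe hX' fun i => by
    rw [real_inner_comm]
    exact ((h𝒱 X).1 hX).2 _ (heW i)

theorem le_evalSp_orthogonal [FiniteDimensional ℝ V] {R : ℝ → V →L[ℝ] V} (hΛ : IsLagrangian R Λ)
    (h𝒱 : ∀ X : ℝ → V, X ∈ 𝒱 ↔ X ∈ Λ ∧ ∀ w ∈ W, ⟪X t₀, w⟫ = 0)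
    (hW : ∀ x ∈ W, ∃ J ∈ Λ, J t₀ = x) : W ≤ (evalSp 𝒱 t₀)ᗮ := by
  rw [← Submodule.le_orthogonal_iff_le_orthogonal, evalSp_le_iff]
  refine ⟨fun X hX => (Submodule.mem_orthogonal' _ _).2 ((h𝒱 X).1 hX).2, fun X hX h0 =>
    (Submodule.mem_orthogonal' _ _).2 fun w hw => ?_⟩
  obtain ⟨K, hK, rfl⟩ := hW w hw
  rw [hΛ.2.2 X ((h𝒱 X).1 hX).1 K hK, h0, inner_zero_left]

end Splitting
/-- **Intermediate Ricci comparison: rigidity (Lemma 8, second part).** Under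
the radial bound `Ric_k ≥ k·κ`, with initial trace condition on a
`k`-dimensional `W ⊆ {J(t₀) : J ∈ Λ}` and `𝒱 = {J ∈ Λ : J(t₀) ⊥ W}` of full
index on `[t₀, t_max)`, if the trace of the Riccati operator on `H(t₁) = 𝒱(t₁)ᗮ`
equals `k·λ̃(t₁)` for some `t₁ ∈ [t₀, t_max)`, then `Λ` splits orthogonally on
`[t₀, t₁]` as `𝒱 ⊕ ℋ`, and every nonzero `K ∈ ℋ` has the form `K = f·E` there,
with `E` a unit vector in `H(t₀)` and `f'' + κ·f = 0`, `f(t₀) = |K(t₀)|`. -/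
theorem intermediate_ricci_comparison_rigidity
    [FiniteDimensional ℝ V]
    (k : ℕ) (κ : ℝ)
    (R : ℝ → V →L[ℝ] V)
    (hR_smooth : ContDiff ℝ (⊤ : ℕ∞) R)
    (hR_sym : ∀ t : ℝ, ∀ x y : V, ⟪R t x, y⟫ = ⟪x, R t y⟫)
    (hRic : ∀ t : ℝ, ∀ e : Fin k → V, Orthonormal ℝ e →
      (k : ℝ) * κ ≤ ∑ i, ⟪R t (e i), e i⟫)
    (Λ : Submodule ℝ (ℝ → V)) (hΛ : IsLagrangian R Λ)
    (t₀ tmax : ℝ) (ht : t₀ < tmax)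
    (lam : ℝ → ℝ)
    (hlam : ∀ t ∈ Set.Ico t₀ tmax, HasDerivAt lam (-(lam t ^ 2) - κ) t)
    (W : Submodule ℝ V) (hWdim : Module.finrank ℝ W = k)
    (hWsub : ∀ x ∈ W, ∃ J ∈ Λ, J t₀ = x)
    (e : Fin k → V) (heW : ∀ i, e i ∈ W) (heON : Orthonormal ℝ e)
    (hespan : Submodule.span ℝ (Set.range e) = W)
    (J : Fin k → (ℝ → V)) (hJΛ : ∀ i, J i ∈ Λ) (hJe : ∀ i, J i t₀ = e i)
    (hinit : ∑ i, ⟪deriv (J i) t₀, e i⟫ ≤ (k : ℝ) * lam t₀)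
    (𝒱 : Submodule ℝ (ℝ → V))
    (h𝒱 : ∀ X : ℝ → V, X ∈ 𝒱 ↔ (X ∈ Λ ∧ ∀ w ∈ W, ⟪X t₀, w⟫ = 0))
    (hfull : ∀ t ∈ Set.Ico t₀ tmax, ∀ X ∈ Λ, X t = 0 → X ∈ 𝒱)
    (t₁ : ℝ) (ht₁ : t₁ ∈ Set.Ico t₀ tmax)
    (x : Fin k → V) (hx : ∀ i, x i ∈ (evalSp 𝒱 t₁)ᗮ) (hxON : Orthonormal ℝ x)
    (hxspan : Submodule.span ℝ (Set.range x) = (evalSp 𝒱 t₁)ᗮ)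
    (K : Fin k → (ℝ → V)) (hKΛ : ∀ i, K i ∈ Λ) (hKx : ∀ i, K i t₁ = x i)
    (heq : ∑ i, ⟪deriv (K i) t₁, x i⟫ = (k : ℝ) * lam t₁) :
    ∃ ℋ : Submodule ℝ (ℝ → V), ℋ ≤ Λ ∧ 𝒱 ⊔ ℋ = Λ ∧ 𝒱 ⊓ ℋ = ⊥ ∧
      (∀ t ∈ Set.Icc t₀ t₁, ∀ X ∈ 𝒱, ∀ Y ∈ ℋ, ⟪X t, Y t⟫ = 0) ∧
      ∀ Y ∈ ℋ, Y ≠ 0 →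
        ∃ (E : V) (f : ℝ → ℝ),
          ‖E‖ = 1 ∧ E ∈ (evalSp 𝒱 t₀)ᗮ ∧
          f t₀ = ‖Y t₀‖ ∧
          (∀ t ∈ Set.Icc t₀ t₁, HasDerivAt f (deriv f t) t) ∧
          (∀ t ∈ Set.Icc t₀ t₁, HasDerivAt (deriv f) (-(κ * f t)) t) ∧
          ∀ t ∈ Set.Icc t₀ t₁, Y t = f t • E := by
  have hR := hR_smooth.continuous
  have h𝒱Λ : 𝒱 ≤ Λ := fun X hX => ((h𝒱 X).1 hX).1
  have hsub : ∀ t ∈ Set.Icc t₀ t₁, t ∈ Set.Ico t₀ tmax := fun t h => ⟨h.1, h.2.trans_lt ht₁.2⟩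
  have hm0 : t₀ ∈ Set.Ico t₀ tmax := ⟨le_rfl, ht⟩
  have hWeq : W = (evalSp 𝒱 t₀)ᗮ := by
    refine Submodule.eq_of_le_of_finrank_eq (le_evalSp_orthogonal hΛ h𝒱 hWsub) ?_
    have h1 := (evalSp 𝒱 t₀).finrank_add_finrank_orthogonal
    have h2 := (evalSp 𝒱 t₁).finrank_add_finrank_orthogonal
    rw [finrank_evalSp hR hΛ h𝒱Λ (hfull t₀ hm0)] at h1
    rw [finrank_evalSp hR hΛ h𝒱Λ (hfull t₁ ht₁), ← hxspan,
      finrank_span_eq_card hxON.linearIndependent, Fintype.card_fin] at h2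
    omega
  have hspanW : ∀ Z : Fin k → ℝ → V, (∀ i, Z i t₀ = e i) →
      ∀ Y ∈ Submodule.span ℝ (Set.range Z), Y t₀ ∈ W := fun Z hZ Y hY => by
    obtain ⟨c, rfl⟩ := (Submodule.mem_span_range_iff_exists_fun ℝ).1 hY
    simp only [Finset.sum_apply, Pi.smul_apply, hZ]
    exact W.sum_mem fun i _ => W.smul_mem _ (heW i)
  have hne : ∀ Z : Fin k → ℝ → V, (∀ i, Z i t₀ = e i) →
      ∀ Y ∈ Submodule.span ℝ (Set.range Z), Y ≠ 0 → Y t₀ ≠ 0 := fun Z hZ Y hY hY0 h0 =>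
    hY0 (eq_zero_of_mem_span_range heON hZ hY fun i => by rw [h0, inner_zero_right])
  have hunit : ∀ v : V, v ≠ 0 → ‖‖v‖⁻¹ • v‖ = 1 := fun v hv => by
    rw [norm_smul, norm_inv, norm_norm, inv_mul_cancel₀ (norm_ne_zero_iff.2 hv)]
  rcases ht₁.1.eq_or_lt with rfl | h01
  · refine ⟨Submodule.span ℝ (Set.range J), Submodule.span_le.2 (Set.range_subset_iff.2 hJΛ),
      sup_span_range_eq h𝒱 heON hespan hJΛ hJe, inf_span_range_eq_bot h𝒱 heON heW hJe, ?_, ?_⟩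
    · intro t htt X hX Y hY
      obtain rfl : t = t₀ := le_antisymm htt.2 htt.1
      exact ((h𝒱 X).1 hX).2 _ (hspanW J hJe Y hY)
    · intro Y hY hY0
      have h0 := hne J hJe Y hY hY0
      let f : ℝ → ℝ := fun t => ‖Y t₀‖ * (1 - κ * (t - t₀) ^ 2 / 2)
      have hf : ∀ t, HasDerivAt f (-(‖Y t₀‖ * κ) * (t - t₀)) t := fun t => by
        have h1 := (((((hasDerivAt_id t).sub_const t₀).pow 2).const_mul κ).div_const 2).const_sub 1
          |>.const_mul ‖Y t₀‖
        refine h1.congr_deriv ?_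
        simp
        ring
      have hf' : deriv f = fun t => -(‖Y t₀‖ * κ) * (t - t₀) := funext fun t => (hf t).deriv
      have hft₀ : f t₀ = ‖Y t₀‖ := by simp [f]
      refine ⟨‖Y t₀‖⁻¹ • Y t₀, f, hunit _ h0,
        hWeq ▸ W.smul_mem _ (hspanW J hJe Y hY), hft₀,
        fun t _ => (hf t).differentiableAt.hasDerivAt, fun t htt => ?_, fun t htt => ?_⟩
      · obtain rfl : t = t₀ := le_antisymm htt.2 htt.1
        rw [hf', hft₀]
        refine (((hasDerivAt_id t).sub_const t).const_mul _).congr_deriv ?_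
        ring
      · obtain rfl : t = t₀ := le_antisymm htt.2 htt.1
        rw [hft₀, smul_inv_smul₀ (norm_ne_zero_iff.2 h0)]
  · obtain ⟨hex, hrig⟩ := rigidity_of_trace_eq hR hR_sym hRic hΛ h𝒱Λ h01
      (fun t htt => hfull t (hsub t htt)) (fun t htt => hlam t (hsub t htt)) heON
      (hespan.trans hWeq) hJΛ hJe hinit hxON hxspan hKΛ hKx heq
    choose Z hZΛ hZe hZ' using fun i => hex (e i) (hWeq ▸ heW i)
    have hℋΛ : Submodule.span ℝ (Set.range Z) ≤ Λ :=
      Submodule.span_le.2 (Set.range_subset_iff.2 hZΛ)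
    have hℋ' : ∀ Y ∈ Submodule.span ℝ (Set.range Z), deriv Y t₀ = lam t₀ • Y t₀ := fun Y hY => by
      induction hY using Submodule.span_induction with
      | mem Y hY =>
        obtain ⟨i, rfl⟩ := hY
        rw [hZ', hZe]
      | zero => simp
      | add A B hA hB hA' hB' =>
        rw [deriv_add (hΛ.differentiableAt (hℋΛ hA) _) (hΛ.differentiableAt (hℋΛ hB) _), hA', hB',
          Pi.add_apply, smul_add]
      | smul c A hA hA' =>
        rw [deriv_const_smul c (hΛ.differentiableAt (hℋΛ hA) _), hA', Pi.smul_apply, smul_comm]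
    have hrigℋ := fun Y hY => hrig Y (hℋΛ hY) (hWeq ▸ hspanW Z hZe Y hY) (hℋ' Y hY)
    refine ⟨Submodule.span ℝ (Set.range Z), hℋΛ, sup_span_range_eq h𝒱 heON hespan hZΛ hZe,
      inf_span_range_eq_bot h𝒱 heON heW hZe, ?_, ?_⟩
    · exact fun t htt X hX Y hY => Submodule.inner_right_of_mem_orthogonal
        (apply_mem_evalSp hX t) (hrigℋ Y hY t htt).1
    · intro Y hY hY0
      have h0 := hne Z hZe Y hY hY0
      obtain ⟨f, h1, h2, h3, h4⟩ := (hΛ.1 Y (hℋΛ hY)).exists_smul_of_deriv_eq h01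
        (fun t htt => hlam t (hsub t htt)) h0 fun t htt => (hrigℋ Y hY t htt).2
      exact ⟨_, f, hunit _ h0, hWeq ▸ W.smul_mem _ (hspanW Z hZe Y hY), h1, h2, h3, h4⟩
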